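/- In any finite execution of the multi-writer auditable register implementation (Algorithm 1), if a reader identifier i belongs to READERS(win) for some sequence win held in the sliding register SLR[x], then there exists a READ operation op by process p_i with idx(op) = x. -/

import Mathlib

/-!
# An operational model of Algorithm 1 (multi-writer auditable register)

The algorithm implements an `n`-writer `m`-reader auditable register from an
unbounded array `SLR[-1,0,1,...]` of `(m+n)`-sliding registers, a max register
`M` storing a triple `(widx, ridx, auditset)` (ordered by its first field,
modelled here as an atomic object), and an array `H[1..m]` of single-writer
registers.  Each line of the pseudo-code is a step; readers, writers and
auditors are modelled by explicit program counters, and executions are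
alternating sequences of configurations and labelled steps starting from the
initial configuration.
-/

namespace Alg1

/-- Values stored in the auditable register. -/
abbrev Val := ℕ

/-- Entries of the sliding registers: `w`-tuples `(w, j, v, h)` posted by
    writers (with `h` a helping set of readers) and reader identifiers. -/
inductive Entry (m n : ℕ) where
  | w (j : Fin n) (v : Val) (h : Finset (Fin m))
  | r (i : Fin m)

variable {m n : ℕ}

def Entry.isW : Entry m n → Bool
  | .w _ _ _ => true
  | .r _ => false

/-- Does the window contain a `w`-tuple? -/
def hasW (win : List (Entry m n)) : Bool := win.any Entry.isW

/-- The first `w`-tuple in a window, if any. -/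
def firstW : List (Entry m n) → Option (Fin n × Val × Finset (Fin m))
  | [] => none
  | .w j v h :: _ => some (j, v, h)
  | .r _ :: rest => firstW rest

/-- `getValue`: the value of the first `w`-tuple of a window (default `0`). -/
def wval (win : List (Entry m n)) : Val := ((firstW win).map fun t => t.2.1).getD 0

/-- Reader identifiers that precede every `w`-tuple of a window. -/
def preW : List (Entry m n) → Finset (Fin m)
  | [] => ∅
  | .w _ _ _ :: _ => ∅
  | .r i :: rest => insert i (preW rest)

/-- `READERS(win)`: readers preceding every `w`-tuple, together with the
    helping set of the first `w`-tuple, if any. -/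
def readersOf (win : List (Entry m n)) : Finset (Fin m) :=
  preW win ∪ ((firstW win).map fun t => t.2.2).getD ∅

/-- Content of the max register `M`: a triple `(widx, ridx, auditset)`,
    ordered by the first field. -/
structure MVal (m : ℕ) where
  widx : ℤ
  ridx : Fin m → ℤ
  aud : Finset (Fin m × Val)

/-- Semantics of `writeMax` on `M`. -/
def wmax (old new : MVal m) : MVal m := if old.widx < new.widx then new else old

/-- The triple written to `M` after reading window `win` from `SLR[x]`:
    `(x+1, ridx[j ∈ READERS(win)] := x, auditset ∪ {(j, lv) : j ∈ READERS(win)})`. -/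
def mArg (mc : MVal m) (win : List (Entry m n)) (x : ℤ) (lv : Val) : MVal m where
  widx := x + 1
  ridx := fun j => if j ∈ readersOf win then x else mc.ridx j
  aud := mc.aud ∪ (readersOf win).image fun j => (j, lv)

/-- Write to a `k`-sliding register: append, keeping the last `k` entries. -/
def slide (k : ℕ) (l : List (Entry m n)) (e : Entry m n) : List (Entry m n) :=
  let l' := l ++ [e]
  l'.drop (l'.length - k)

/-- Program counter of a reader (one state per line of the pseudo-code). -/
inductive RPC where
  | idle
  | precheck   -- read `SLR[lsr]` (line `rd_last_wd`)
  | preM       -- read `M` (line `new_write`)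
  | preHelp    -- `writeMax` on `M` (line `rd_help_M1`)
  | loopM      -- read `M` at the head of the repeat loop (line `rd_M`)
  | helpVal    -- found help: read `SLR[lsr-1]` (`getValue`, line `rd_return_help`)
  | annH       -- write `H[i] := lsr` (line `rd_annouce_att`)
  | wSLR       -- write `i` to `SLR[lsr]` (line `rd_do_att`)
  | rSLR       -- read `SLR[lsr]` (line `rd_do_att`)
  | gVal       -- read `SLR[lsr-1]` (`getValue`, line `rd_val`)
  | helpChk    -- help the pending write to complete (line `rd_help_M2`)
  | loopEnd    -- evaluate the until condition (line `rd_att_success`)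
  | retNow     -- return `lval`

structure RState (m n : ℕ) where
  lsr : ℤ
  lval : Val
  mc : MVal m
  win : List (Entry m n)
  it : ℕ          -- number of iterations of the repeat loop of the current READ
  pc : RPC

/-- Program counter of a writer. -/
inductive WPC where
  | idle
  | readM    -- read `M` (line `w_read_M`)
  | scanH    -- read `H[k]` (line `w_att`)
  | scanS    -- read `SLR[a_k]` (line `w_help_wd`)
  | post     -- write the `w`-tuple to `SLR[widx]` (line `w_write_SLR`)
  | postR    -- read `SLR[widx]`
  | postV    -- read `SLR[widx-1]` (`getValue`)
  | postM    -- `writeMax` on `M` (line `w_write_M`)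
  | wret     -- return

structure WState (m n : ℕ) where
  v : Val
  mc : MVal m
  toHelp : Finset (Fin m)
  k : ℕ
  a : ℤ
  win : List (Entry m n)
  val : Val
  pc : WPC

/-- Program counter of an auditor. -/
inductive APC where
  | idle
  | aM       -- read `M` (line `adt_read_M`)
  | aR       -- read `SLR[widx]` (line `adt_val`)
  | aV       -- read `SLR[widx-1]` (`getValue`, line `adt_val`)
  | aret     -- return the audit set

structure AState (m n : ℕ) where
  mc : MVal m
  win : List (Entry m n)
  val : Val
  pc : APC

/-- Processes: `m` readers, `n` writers, and arbitrarily many auditors. -/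
inductive Proc (m n : ℕ) where
  | rdr (i : Fin m)
  | wtr (j : Fin n)
  | adt (a : ℕ)
  deriving DecidableEq

/-- A configuration: shared memory plus the local state of every process. -/
structure Config (m n : ℕ) where
  slr : ℤ → List (Entry m n)
  M : MVal m
  H : Fin m → ℤ
  rst : Fin m → RState m n
  wst : Fin n → WState m n
  ast : ℕ → AState m n

/-- Step labels: invocations and responses of high-level operations, and
    primitive operations applied to the base objects. -/
inductive Lbl (m n : ℕ) where
  | invRead (i : Fin m)
  | respRead (i : Fin m) (v : Val)
  | invWrite (j : Fin n) (v : Val)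
  | respWrite (j : Fin n)
  | invAudit (a : ℕ)
  | respAudit (a : ℕ) (A : Finset (Fin m × Val))
  | slrRead (p : Proc m n) (x : ℤ) (win : List (Entry m n))
  | slrWrite (p : Proc m n) (x : ℤ) (e : Entry m n)
  | mRead (p : Proc m n) (v : MVal m)
  | mWrite (p : Proc m n) (v : MVal m)
  | hRead (j : Fin n) (k : Fin m) (a : ℤ)
  | hWrite (i : Fin m) (x : ℤ)
  | tau (p : Proc m n)

def upR (c : Config m n) (i : Fin m) (s : RState m n) : Config m n :=
  { c with rst := Function.update c.rst i s }

def upW (c : Config m n) (j : Fin n) (s : WState m n) : Config m n :=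
  { c with wst := Function.update c.wst j s }

def upA (c : Config m n) (a : ℕ) (s : AState m n) : Config m n :=
  { c with ast := Function.update c.ast a s }

/-- The transition relation of Algorithm 1. -/
def Step (c : Config m n) (l : Lbl m n) (c' : Config m n) : Prop :=
  match l with
  | .invRead i =>
      let s := c.rst i
      s.pc = .idle ∧
      c' = upR c i { s with it := 0, pc := if 0 ≤ s.lsr then RPC.precheck else RPC.loopM }
  | .respRead i v =>
      let s := c.rst i
      s.pc = .retNow ∧ v = s.lval ∧ c' = upR c i { s with pc := .idle }
  | .invWrite j v =>
      let s := c.wst j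
      s.pc = .idle ∧ c' = upW c j { s with v := v, pc := .readM }
  | .respWrite j =>
      let s := c.wst j
      s.pc = .wret ∧ c' = upW c j { s with pc := .idle }
  | .invAudit a =>
      let s := c.ast a
      s.pc = .idle ∧ c' = upA c a { s with pc := .aM }
  | .respAudit a A =>
      let s := c.ast a
      s.pc = .aret ∧
      A = s.mc.aud ∪ (readersOf s.win).image (fun j => (j, s.val)) ∧
      c' = upA c a { s with pc := .idle }
  | .slrRead p x win =>
      win = c.slr x ∧
      (match p with
       | .rdr i =>
          let s := c.rst i
          (s.pc = .precheck ∧ x = s.lsr ∧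
             c' = upR c i { s with win := win, pc := if hasW win then RPC.preM else RPC.retNow }) ∨
          (s.pc = .helpVal ∧ x = s.lsr - 1 ∧
             c' = upR c i { s with lval := wval win, pc := .retNow }) ∨
          (s.pc = .rSLR ∧ x = s.lsr ∧
             c' = upR c i { s with win := win, pc := .gVal }) ∨
          (s.pc = .gVal ∧ x = s.lsr - 1 ∧
             c' = upR c i { s with lval := wval win, pc := .helpChk })
       | .wtr j =>
          let s := c.wst j
          (s.pc = .scanS ∧ x = s.a ∧
             (∃ hk : s.k < m,
               c' = upW c j { s with toHelp := if (⟨s.k, hk⟩ : Fin m) ∈ readersOf win then s.toHelp else insert (⟨s.k, hk⟩ : Fin m) s.toHelp, k := s.k + 1, pc := .scanH })) ∨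
          (s.pc = .postR ∧ x = s.mc.widx ∧
             c' = upW c j { s with win := win, pc := .postV }) ∨
          (s.pc = .postV ∧ x = s.mc.widx - 1 ∧
             c' = upW c j { s with val := wval win, pc := .postM })
       | .adt a =>
          let s := c.ast a
          (s.pc = .aR ∧ x = s.mc.widx ∧
             c' = upA c a { s with win := win, pc := .aV }) ∨
          (s.pc = .aV ∧ x = s.mc.widx - 1 ∧
             c' = upA c a { s with val := wval win, pc := .aret }))
  | .slrWrite p x e =>
      (match p with
       | .rdr i =>
          let s := c.rst i
          s.pc = .wSLR ∧ x = s.lsr ∧ e = .r i ∧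
          c' = { upR c i { s with pc := .rSLR } with
                 slr := Function.update c.slr x (slide (m + n) (c.slr x) e) }
       | .wtr j =>
          let s := c.wst j
          s.pc = .post ∧ x = s.mc.widx ∧ e = .w j s.v s.toHelp ∧
          c' = { upW c j { s with pc := .postR } with
                 slr := Function.update c.slr x (slide (m + n) (c.slr x) e) }
       | .adt _ => False)
  | .mRead p v =>
      v = c.M ∧
      (match p with
       | .rdr i =>
          let s := c.rst i
          (s.pc = .preM ∧
             c' = upR c i { s with mc := v, pc := if v.widx = s.lsr then RPC.preHelp else RPC.loopM }) ∨
          (s.pc = .loopM ∧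
             c' = upR c i (if s.lsr < v.ridx i then
                { s with mc := v, it := s.it + 1, lsr := v.ridx i, pc := .helpVal }
              else
                { s with mc := v, it := s.it + 1, lsr := v.widx, pc := .annH }))
       | .wtr j =>
          let s := c.wst j
          s.pc = .readM ∧
          c' = upW c j { s with mc := v, toHelp := ∅, k := 0, pc := .scanH }
       | .adt a =>
          let s := c.ast a
          s.pc = .aM ∧ c' = upA c a { s with mc := v, pc := .aR })
  | .mWrite p v =>
      (match p with
       | .rdr i =>
          let s := c.rst i
          (s.pc = .preHelp ∧ v = mArg s.mc s.win s.lsr s.lval ∧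
             c' = { upR c i { s with pc := .loopM } with M := wmax c.M v }) ∨
          (s.pc = .helpChk ∧ hasW s.win = true ∧ v = mArg s.mc s.win s.lsr s.lval ∧
             c' = { upR c i { s with pc := .loopEnd } with M := wmax c.M v })
       | .wtr j =>
          let s := c.wst j
          s.pc = .postM ∧ v = mArg s.mc s.win s.mc.widx s.val ∧
          c' = { upW c j { s with pc := .wret } with M := wmax c.M v }
       | .adt _ => False)
  | .hRead j k a =>
      let s := c.wst j
      s.pc = .scanH ∧ (k : ℕ) = s.k ∧ a = c.H k ∧
      c' = upW c j (if s.mc.ridx k < a then { s with a := a, pc := .scanS }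
                    else { s with k := s.k + 1 })
  | .hWrite i x =>
      let s := c.rst i
      s.pc = .annH ∧ x = s.lsr ∧
      c' = { upR c i { s with pc := .wSLR } with H := Function.update c.H i x }
  | .tau p =>
      match p with
      | .rdr i =>
          let s := c.rst i
          (s.pc = .helpChk ∧ hasW s.win = false ∧
             c' = upR c i { s with pc := .loopEnd }) ∨
          (s.pc = .loopEnd ∧
             c' = upR c i { s with pc := if i ∈ readersOf s.win then RPC.retNow else RPC.loopM })
      | .wtr j =>
          let s := c.wst j
          s.pc = .scanH ∧ s.k = m ∧ c' = upW c j { s with pc := .post }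
      | .adt _ => False

/-- The initial configuration: `SLR[-1]` holds `(w, j₀, v₀, ∅)`, all other
    sliding registers are empty, `M = (0, [-1,…,-1], ∅)`, `H = [-1,…,-1]`,
    and every process is idle (readers start with `lsr = -1`). -/
def init (m n : ℕ) (v0 : Val) (j0 : Fin n) : Config m n where
  slr := fun x => if x = -1 then [.w j0 v0 ∅] else []
  M := ⟨0, fun _ => -1, ∅⟩
  H := fun _ => -1
  rst := fun _ => ⟨-1, v0, ⟨0, fun _ => -1, ∅⟩, [], 0, .idle⟩
  wst := fun _ => ⟨v0, ⟨0, fun _ => -1, ∅⟩, ∅, 0, -1, [], v0, .idle⟩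
  ast := fun _ => ⟨⟨0, fun _ => -1, ∅⟩, [], v0, .idle⟩

/-- A finite execution of Algorithm 1: configurations `cfg 0, …, cfg len`
    connected by labelled steps. -/
structure Exec (m n : ℕ) (v0 : Val) (j0 : Fin n) where
  len : ℕ
  cfg : ℕ → Config m n
  lbl : ℕ → Lbl m n
  h0 : cfg 0 = init m n v0 j0
  hstep : ∀ t, t < len → Step (cfg t) (lbl t) (cfg (t + 1))

variable {v0 : Val} {j0 : Fin n}

/-! ### Derived notions -/

/-- The process performing a step. -/
def procOf : Lbl m n → Proc m n
  | .invRead i => .rdr i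
  | .respRead i _ => .rdr i
  | .invWrite j _ => .wtr j
  | .respWrite j => .wtr j
  | .invAudit a => .adt a
  | .respAudit a _ => .adt a
  | .slrRead p _ _ => p
  | .slrWrite p _ _ => p
  | .mRead p _ => p
  | .mWrite p _ => p
  | .hRead j _ _ => .wtr j
  | .hWrite i _ => .rdr i
  | .tau p => p

/-- The label writes a `w`-tuple to `SLR[x]`. -/
def isWWrite (l : Lbl m n) (x : ℤ) : Prop :=
  ∃ p j v h, l = .slrWrite p x (.w j v h)

/-- Step `t` is the first write of a `w`-tuple to `SLR[x]` in the execution. -/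
def FirstWWriteAt (E : Exec m n v0 j0) (x : ℤ) (t : ℕ) : Prop :=
  t < E.len ∧ isWWrite (E.lbl t) x ∧ ∀ t', t' < t → ¬ isWWrite (E.lbl t') x

/-- Step `t` changes `M.widx` from `ℓ - 1` to `ℓ`. -/
def WidxChangeAt (E : Exec m n v0 j0) (ℓ : ℤ) (t : ℕ) : Prop :=
  t < E.len ∧ (∃ p v, E.lbl t = .mWrite p v) ∧
  (E.cfg t).M.widx = ℓ - 1 ∧ (E.cfg (t + 1)).M.widx = ℓ

/-- `x` is the largest index of a sliding register containing a `w`-tuple. -/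
def WIDXis (c : Config m n) (x : ℤ) : Prop :=
  hasW (c.slr x) = true ∧ ∀ y : ℤ, x < y → hasW (c.slr y) = false

/-- Configuration in region `D_ℓ`: `M.widx = ℓ = WIDX + 1`. -/
def inD (c : Config m n) (ℓ : ℤ) : Prop := c.M.widx = ℓ ∧ WIDXis c (ℓ - 1)

/-- Configuration in region `E_ℓ`: `M.widx = ℓ = WIDX`. -/
def inE (c : Config m n) (ℓ : ℤ) : Prop := c.M.widx = ℓ ∧ WIDXis c ℓ

/-! ### Classification of operations, and linearizations -/

/-- Classification of the operations of Algorithm 1. -/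
inductive Kind where
  | silentR | directR | helpedR | visibleW | hiddenW | defA | nondefA
  deriving DecidableEq

/-- Rank used by the linearization rules `R1`–`R4` within a block of
    operations with the same index. -/
def rank : Kind → ℕ
  | .silentR => 0
  | .directR => 0
  | .nondefA => 0
  | .helpedR => 1
  | .defA => 2
  | .hiddenW => 3
  | .visibleW => 4

def Kind.isRead : Kind → Prop
  | .silentR => True | .directR => True | .helpedR => True
  | _ => False

def Kind.isWrite : Kind → Prop
  | .visibleW => True | .hiddenW => True
  | _ => False

def Kind.isAudit : Kind → Prop
  | .defA => True | .nondefA => True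
  | _ => False

/-- The data of a classified operation: its process, invocation step, optional
    response step, kind, associated sliding-register index `idx`, its
    characteristic step `key` on `SLR[idx]` (used by the linearization rules),
    its value (return value of a READ / input of a WRITE) and, for an AUDIT,
    the returned audit set. -/
structure OpData (m n : ℕ) where
  proc : Proc m n
  inv : ℕ
  resp : Option ℕ
  kind : Kind
  idx : ℤ
  key : ℕ
  val : Val
  aset : Finset (Fin m × Val)

/-- The label is a response event of process `p`. -/
def isRespOf (l : Lbl m n) (p : Proc m n) : Prop :=
  (∃ i v, p = .rdr i ∧ l = .respRead i v) ∨
  (∃ j, p = .wtr j ∧ l = .respWrite j) ∨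
  (∃ a A, p = .adt a ∧ l = .respAudit a A)

/-- `resp` is the matching response of the operation of `p` invoked at `a`
    (or the operation is pending if `resp = none`). -/
def RespMatch (E : Exec m n v0 j0) (p : Proc m n) (a : ℕ) : Option ℕ → Prop
  | some b => a < b ∧ b < E.len ∧ isRespOf (E.lbl b) p ∧
      ∀ t, a < t → t < b → ¬ isRespOf (E.lbl t) p
  | none => ∀ t, a < t → t < E.len → ¬ isRespOf (E.lbl t) p

/-- `x` is the smallest index `> x0` of a sliding register in which reader `i`
    is recorded (evaluated in the final configuration). -/
def minRecIdx (E : Exec m n v0 j0) (i : Fin m) (x0 x : ℤ) : Prop :=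
  x0 < x ∧ i ∈ readersOf ((E.cfg E.len).slr x) ∧
    ∀ y : ℤ, x0 < y → y < x → i ∉ readersOf ((E.cfg E.len).slr y)

/-- The return value of a classified READ: the actual response if the READ is
    complete; for a pending classified READ (completed in `H'`), the value of
    the first `w`-tuple of `SLR[idx-1]`. -/
def ReadValOK (E : Exec m n v0 j0) (o : OpData m n) (i : Fin m) : Prop :=
  match o.resp with
  | some b => E.lbl b = .respRead i o.val
  | none => o.val = wval ((E.cfg E.len).slr (o.idx - 1))

/-- `o` describes a classified operation of the execution `E`. -/
def IsOp (E : Exec m n v0 j0) (o : OpData m n) : Prop :=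
  o.inv < E.len ∧ RespMatch E o.proc o.inv o.resp ∧
  match o.kind with
  | .silentR =>
      ∃ i b win, o.proc = .rdr i ∧ o.resp = some b ∧
        E.lbl o.inv = .invRead i ∧
        (∃ t', t' < o.inv ∧ E.lbl t' = .invRead i) ∧
        o.idx = ((E.cfg o.inv).rst i).lsr ∧
        o.inv < o.key ∧ o.key < b ∧
        E.lbl o.key = .slrRead (.rdr i) o.idx win ∧
        ((E.cfg o.key).rst i).pc = .precheck ∧
        hasW win = false ∧
        E.lbl b = .respRead i o.val ∧
        o.aset = ∅
  | .directR =>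
      ∃ i, o.proc = .rdr i ∧ E.lbl o.inv = .invRead i ∧
        minRecIdx E i ((E.cfg o.inv).rst i).lsr o.idx ∧
        i ∈ preW ((E.cfg E.len).slr o.idx) ∧
        o.inv < o.key ∧ o.key < E.len ∧
        E.lbl o.key = .slrWrite (.rdr i) o.idx (.r i) ∧
        (∀ b, o.resp = some b → o.key < b) ∧
        ReadValOK E o i ∧ o.aset = ∅
  | .helpedR =>
      ∃ i, o.proc = .rdr i ∧ E.lbl o.inv = .invRead i ∧
        minRecIdx E i ((E.cfg o.inv).rst i).lsr o.idx ∧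
        i ∉ preW ((E.cfg E.len).slr o.idx) ∧
        o.key = o.inv ∧ ReadValOK E o i ∧ o.aset = ∅
  | .visibleW =>
      ∃ j h, o.proc = .wtr j ∧ E.lbl o.inv = .invWrite j o.val ∧
        o.inv < o.key ∧ o.key < E.len ∧
        E.lbl o.key = .slrWrite (.wtr j) o.idx (.w j o.val h) ∧
        (∀ b, o.resp = some b → o.key < b) ∧
        firstW ((E.cfg E.len).slr o.idx) = some (j, o.val, h) ∧
        o.aset = ∅
  | .hiddenW =>
      ∃ j h, o.proc = .wtr j ∧ E.lbl o.inv = .invWrite j o.val ∧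
        o.inv < o.key ∧ o.key < E.len ∧
        E.lbl o.key = .slrWrite (.wtr j) o.idx (.w j o.val h) ∧
        (∀ b, o.resp = some b → o.key < b) ∧
        firstW ((E.cfg E.len).slr o.idx) ≠ some (j, o.val, h) ∧
        o.aset = ∅
  | .defA =>
      ∃ a b tM mv win, o.proc = .adt a ∧ o.resp = some b ∧
        E.lbl o.inv = .invAudit a ∧
        o.inv < tM ∧ tM < o.key ∧ o.key < b ∧
        E.lbl tM = .mRead (.adt a) mv ∧ ((E.cfg tM).ast a).pc = .aM ∧
        o.idx = mv.widx ∧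
        E.lbl o.key = .slrRead (.adt a) o.idx win ∧
        ((E.cfg o.key).ast a).pc = .aR ∧
        hasW win = true ∧
        E.lbl b = .respAudit a o.aset ∧ o.val = 0
  | .nondefA =>
      ∃ a b tM mv win, o.proc = .adt a ∧ o.resp = some b ∧
        E.lbl o.inv = .invAudit a ∧
        o.inv < tM ∧ tM < o.key ∧ o.key < b ∧
        E.lbl tM = .mRead (.adt a) mv ∧ ((E.cfg tM).ast a).pc = .aM ∧
        o.idx = mv.widx ∧
        E.lbl o.key = .slrRead (.adt a) o.idx win ∧
        ((E.cfg o.key).ast a).pc = .aR ∧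
        hasW win = false ∧
        E.lbl b = .respAudit a o.aset ∧ o.val = 0

/-- `o` terminates (its response event occurs) before `o'` starts. -/
def EndsBefore (o o' : OpData m n) : Prop :=
  ∃ b, o.resp = some b ∧ b < o'.inv

/-- `lt` is a linearization of the classified operations of `E` obeying the
    rules `R0`–`R4`: a strict total order on classified operations, ordering
    operations by increasing `idx` (`R0`); within the same `idx`, first
    silent READs, direct READs and non-definitive AUDITs ordered by their
    characteristic step on `SLR[idx]` (`R1`), then helped READs in arbitrary
    order followed by the definitive AUDITs ordered by their read of
    `SLR[idx]` (`R2`), then the hidden WRITEs ordered by their write to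
    `SLR[idx]` (`R3`), and the visible WRITE last (`R4`). -/
def LinOK (E : Exec m n v0 j0) (lt : OpData m n → OpData m n → Prop) : Prop :=
  (∀ o, IsOp E o → ¬ lt o o) ∧
  (∀ o₁ o₂ o₃, IsOp E o₁ → IsOp E o₂ → IsOp E o₃ →
      lt o₁ o₂ → lt o₂ o₃ → lt o₁ o₃) ∧
  (∀ o₁ o₂, IsOp E o₁ → IsOp E o₂ → o₁ ≠ o₂ → lt o₁ o₂ ∨ lt o₂ o₁) ∧
  (∀ o₁ o₂, IsOp E o₁ → IsOp E o₂ → o₁.idx < o₂.idx → lt o₁ o₂) ∧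
  (∀ o₁ o₂, IsOp E o₁ → IsOp E o₂ → o₁.idx = o₂.idx →
      rank o₁.kind < rank o₂.kind → lt o₁ o₂) ∧
  (∀ o₁ o₂, IsOp E o₁ → IsOp E o₂ → o₁.idx = o₂.idx →
      rank o₁.kind = rank o₂.kind → o₁.kind ≠ .helpedR →
      o₁.key < o₂.key → lt o₁ o₂)

/-! ### Lists of entries -/

/-- The identity of the author of an entry. -/
def ekey : Entry m n → Fin m ⊕ Fin n
  | .w j _ _ => .inr j
  | .r i => .inl i

theorem hasW_append (l l' : List (Entry m n)) : hasW (l ++ l') = (hasW l || hasW l') := by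
  simp [hasW]

theorem firstW_append_of_hasW (l l' : List (Entry m n)) (h : hasW l = true) :
    firstW (l ++ l') = firstW l := by
  induction l with
  | nil => simp [hasW] at h
  | cons a l ih =>
    cases a with
    | w j v s => simp [firstW]
    | r i =>
      have : hasW l = true := by simpa [hasW, Entry.isW] using h
      simpa [firstW] using ih this

theorem preW_append_of_hasW (l l' : List (Entry m n)) (h : hasW l = true) :
    preW (l ++ l') = preW l := by
  induction l with
  | nil => simp [hasW] at h
  | cons a l ih =>
    cases a with
    | w j v s => simp [preW]
    | r i =>
      have : hasW l = true := by simpa [hasW, Entry.isW] using h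
      simp [preW, ih this]

theorem firstW_append_of_not (l l' : List (Entry m n)) (h : hasW l = false) :
    firstW (l ++ l') = firstW l' := by
  induction l with
  | nil => simp
  | cons a l ih =>
    cases a with
    | w j v s => simp [hasW, Entry.isW] at h
    | r i =>
      have : hasW l = false := by simpa [hasW, Entry.isW] using h
      simpa [firstW] using ih this

theorem firstW_of_not (l : List (Entry m n)) (h : hasW l = false) : firstW l = none := by
  simpa [firstW] using firstW_append_of_not l [] h

theorem preW_append_of_not (l l' : List (Entry m n)) (h : hasW l = false) :
    preW (l ++ l') = preW l ∪ preW l' := by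
  induction l with
  | nil => simp [preW]
  | cons a l ih =>
    cases a with
    | w j v s => simp [hasW, Entry.isW] at h
    | r i =>
      have : hasW l = false := by simpa [hasW, Entry.isW] using h
      simp [preW, ih this]

theorem hasW_prefix {l l' : List (Entry m n)} (hp : l <+: l') (h : hasW l = true) :
    hasW l' = true := by
  obtain ⟨k, rfl⟩ := hp
  simp [hasW_append, h]

theorem preW_prefix {l l' : List (Entry m n)} (hp : l <+: l') (h : hasW l = true) :
    preW l' = preW l := by
  obtain ⟨k, rfl⟩ := hp
  exact preW_append_of_hasW _ _ h

theorem readersOf_prefix_eq {l l' : List (Entry m n)} (hp : l <+: l') (h : hasW l = true) :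
    readersOf l' = readersOf l := by
  obtain ⟨k, rfl⟩ := hp
  simp [readersOf, preW_append_of_hasW _ _ h, firstW_append_of_hasW _ _ h]

theorem readersOf_of_not {l : List (Entry m n)} (h : hasW l = false) :
    readersOf l = preW l := by
  simp [readersOf, firstW_of_not l h]

theorem readersOf_prefix {l l' : List (Entry m n)} (hp : l <+: l') {i : Fin m}
    (hi : i ∈ readersOf l) : i ∈ readersOf l' := by
  cases h : hasW l with
  | true => rwa [readersOf_prefix_eq hp h]
  | false =>
    obtain ⟨k, rfl⟩ := hp
    rw [readersOf_of_not h] at hi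
    simp [readersOf, preW_append_of_not _ _ h, hi]

theorem mem_preW_of_not {l : List (Entry m n)} {i : Fin m} (h : hasW l = false)
    (hi : Sum.inl i ∈ l.map ekey) : i ∈ preW l := by
  induction l with
  | nil => simp at hi
  | cons a l ih =>
    cases a with
    | w j v s => simp [hasW, Entry.isW] at h
    | r i' =>
      have : hasW l = false := by simpa [hasW, Entry.isW] using h
      simp only [List.map_cons, List.mem_cons, ekey] at hi
      rcases hi with hi | hi
      · simp only [Sum.inl.injEq] at hi
        simp [preW, hi]
      · simp [preW, ih this hi]

theorem hasW_of_mem {l : List (Entry m n)} {i : Fin m}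
    (hi : Sum.inl i ∈ l.map ekey) (hn : i ∉ readersOf l) : hasW l = true := by
  by_contra h
  have h : hasW l = false := by simpa using h
  exact hn (by rw [readersOf_of_not h]; exact mem_preW_of_not h hi)

theorem readersOf_append {l : List (Entry m n)} {e : Entry m n} {i : Fin m}
    (hi : i ∈ readersOf (l ++ [e])) (hn : i ∉ readersOf l) :
    hasW l = false ∧ ((e = .r i) ∨
      (∃ j v h, e = .w j v h ∧ i ∈ h ∧ i ∉ preW (l ++ [e]) ∧ hasW (l ++ [e]) = true)) := by
  cases h : hasW l with
  | true => rw [readersOf_prefix_eq (List.prefix_append l [e]) h] at hi; exact absurd hi hn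
  | false =>
    refine ⟨rfl, ?_⟩
    rw [readersOf_of_not h] at hn
    simp only [readersOf, preW_append_of_not _ _ h, firstW_append_of_not _ _ h] at hi ⊢
    cases e with
    | r i' => simp [preW, firstW, hn] at hi; simp [hi]
    | w j v s =>
      simp [preW, firstW, hn] at hi
      refine Or.inr ⟨j, v, s, rfl, hi, ?_, ?_⟩
      · simpa [preW] using hn
      · simp [hasW, Entry.isW]

theorem slide_eq {l : List (Entry m n)} {e : Entry m n}
    (h : ((l ++ [e]).map ekey).Nodup) : slide (m + n) l e = l ++ [e] := by
  have := h.length_le_card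
  simp only [List.length_map, Fintype.card_sum, Fintype.card_fin] at this
  simp only [slide]
  rw [Nat.sub_eq_zero_of_le this]
  simp

/-! ### Invariants -/

/-- Every triple stored in `M` describes faithfully the records below `widx`. -/
structure Valid (slr : ℤ → List (Entry m n)) (mv : MVal m) : Prop where
  lo : 0 ≤ mv.widx
  hw : ∀ y, -1 ≤ y → y < mv.widx → hasW (slr y) = true
  rlo : ∀ j, -1 ≤ mv.ridx j
  rlt : ∀ j, mv.ridx j < mv.widx
  rrec : ∀ j, mv.ridx j = -1 ∨ j ∈ readersOf (slr (mv.ridx j))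
  rmax : ∀ j y, mv.ridx j < y → y < mv.widx → j ∉ readersOf (slr y)

theorem Valid.ext {slr slr' : ℤ → List (Entry m n)} {mv : MVal m}
    (hv : Valid slr mv) (hp : ∀ x, slr x <+: slr' x) : Valid slr' mv where
  lo := hv.lo
  hw y h1 h2 := hasW_prefix (hp y) (hv.hw y h1 h2)
  rlo := hv.rlo
  rlt := hv.rlt
  rrec j := (hv.rrec j).imp id (readersOf_prefix (hp _))
  rmax j y h1 h2 := by
    have := hv.rlo j
    rw [readersOf_prefix_eq (hp y) (hv.hw y (by omega) h2)]
    exact hv.rmax j y h1 h2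

theorem Valid.mArg {slr : ℤ → List (Entry m n)} {mv : MVal m} {win : List (Entry m n)}
    {x : ℤ} {lv : Val} (hv : Valid slr mv) (hx : mv.widx = x) (hp : win <+: slr x)
    (hw : hasW win = true) : Valid slr (mArg mv win x lv) := by
  have hr := readersOf_prefix_eq hp hw
  have h0 := hv.lo
  refine ⟨?_, ?_, ?_, ?_, ?_, ?_⟩
  · simp only [Alg1.mArg]; omega
  · intro y h1 h2
    simp only [Alg1.mArg] at h2
    by_cases h : y = x
    · subst h; exact hasW_prefix hp hw
    · exact hv.hw y h1 (by omega)
  · intro j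
    have := hv.rlo j
    simp only [Alg1.mArg]; split <;> omega
  · intro j
    have := hv.rlt j
    simp only [Alg1.mArg]; split <;> omega
  · intro j
    simp only [Alg1.mArg]
    split
    · rename_i h; right; rwa [hr]
    · exact hv.rrec j
  · intro j y h1 h2
    simp only [Alg1.mArg] at h1 h2
    split at h1
    · omega
    · rename_i h
      by_cases hy : y = x
      · subst hy; rwa [hr]
      · exact hv.rmax j y h1 (by omega)

/-- Invariant of reader `i`; `mw` is `M.widx`, `hi` is `H[i]` and `g` is the value of `lsr`
    at the last invocation of a READ. -/
structure RI (slr : ℤ → List (Entry m n)) (mw hi g : ℤ) (i : Fin m) (s : RState m n) : Prop where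
  lo : -1 ≤ s.lsr
  le : s.lsr ≤ mw
  hle : hi ≤ s.lsr
  mem_le : ∀ x, Sum.inl i ∈ (slr x).map ekey → x ≤ s.lsr
  mem_lt : s.pc = .annH ∨ s.pc = .wSLR → ∀ x, Sum.inl i ∈ (slr x).map ekey → x < s.lsr
  mcv : Valid slr s.mc
  loop : s.pc = .loopM → s.lsr < mw
  win : s.pc = .gVal ∨ s.pc = .helpChk ∨ s.pc = .loopEnd ∨ s.pc = .preM ∨ s.pc = .preHelp →
    s.win <+: slr s.lsr
  hasw : s.pc = .preM ∨ s.pc = .preHelp → hasW s.win = true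
  mcw : s.pc = .preHelp ∨ s.pc = .annH ∨ s.pc = .wSLR ∨ s.pc = .rSLR ∨ s.pc = .gVal ∨
    s.pc = .helpChk ∨ s.pc = .loopEnd → s.mc.widx = s.lsr
  memwin : s.pc = .gVal ∨ s.pc = .helpChk ∨ s.pc = .loopEnd → Sum.inl i ∈ s.win.map ekey
  memslr : s.pc = .rSLR → Sum.inl i ∈ (slr s.lsr).map ekey
  done : s.pc = .loopEnd → hasW s.win = true → s.lsr < mw
  grec : g = -1 ∨ i ∈ readersOf (slr g)
  gle : g ≤ s.lsr
  glt : s.pc = .helpVal ∨ s.pc = .annH ∨ s.pc = .wSLR ∨ s.pc = .rSLR ∨ s.pc = .gVal ∨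
    s.pc = .helpChk ∨ s.pc = .loopEnd → g < s.lsr
  pre : s.pc = .precheck ∨ s.pc = .preM ∨ s.pc = .preHelp → s.lsr = g
  fin : s.pc = .idle ∨ s.pc = .retNow →
    (i ∈ readersOf (slr s.lsr) ∧ g < s.lsr) ∨ (hi ≤ g ∧ s.lsr = g)
  hv : s.pc = .helpVal → i ∈ readersOf (slr s.lsr)
  kl : s.pc = .loopM → ∀ y, i ∈ readersOf (slr y) → g < y → s.lsr < y
  ka : s.pc = .annH ∨ s.pc = .wSLR ∨ s.pc = .rSLR ∨ s.pc = .gVal ∨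
    s.pc = .helpChk ∨ s.pc = .loopEnd → ∀ y, i ∈ readersOf (slr y) → g < y → s.lsr ≤ y
  hr : ∀ y, i ∈ readersOf (slr y) → g < y → hi ≤ y

theorem RI.env {slr slr' : ℤ → List (Entry m n)} {mw mw' hi g : ℤ} {i : Fin m} {s : RState m n}
    (h : RI slr mw hi g i s) (hp : ∀ x, slr x <+: slr' x) (hm : mw ≤ mw')
    (hmem : ∀ x, Sum.inl i ∈ (slr' x).map ekey → Sum.inl i ∈ (slr x).map ekey)
    (hrec : ∀ y, i ∈ readersOf (slr' y) → i ∈ readersOf (slr y) ∨ y = mw) :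
    RI slr' mw' hi g i s := by
  have hle := h.le
  have hhle := h.hle
  refine ⟨h.lo, by omega, h.hle, fun x hx => h.mem_le x (hmem x hx),
    fun hpc x hx => h.mem_lt hpc x (hmem x hx), h.mcv.ext hp, fun hpc => by have := h.loop hpc; omega,
    fun hpc => (h.win hpc).trans (hp _), h.hasw, h.mcw, h.memwin, ?_, 
    fun hpc hw => by have := h.done hpc hw; omega, h.grec.imp id (readersOf_prefix (hp _)), 
    h.gle, h.glt, h.pre, ?_, fun hpc => readersOf_prefix (hp _) (h.hv hpc), ?_, ?_, ?_⟩
  · intro hpc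
    exact List.map_subset _ (hp _).subset (h.memslr hpc)
  · intro hpc
    exact (h.fin hpc).imp (fun q => ⟨readersOf_prefix (hp _) q.1, q.2⟩) id
  · intro hpc y hy hg
    rcases hrec y hy with hy | rfl
    · exact h.kl hpc y hy hg
    · exact h.loop hpc
  · intro hpc y hy hg
    rcases hrec y hy with hy | rfl
    · exact h.ka hpc y hy hg
    · exact h.le
  · intro y hy hg
    rcases hrec y hy with hy | rfl
    · exact h.hr y hy hg
    · omega

/-- Reader `i` is either recorded in `SLR[l]` or has announced itself in its current READ and is
    not recorded yet. -/
def QQ (slr : ℤ → List (Entry m n)) (hi g : ℤ) (i : Fin m) (l : ℤ) : Prop :=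
  i ∈ readersOf (slr l) ∨ ((∀ y, i ∈ readersOf (slr y) → y ≤ g) ∧ g < hi)

/-- Invariant of writer `j`. -/
structure WI (slr : ℤ → List (Entry m n)) (mw : ℤ) (H G : Fin m → ℤ) (j : Fin n)
    (s : WState m n) : Prop where
  mcv : Valid slr s.mc
  mcle : s.mc.widx ≤ mw
  memw : ∀ x, Sum.inr j ∈ (slr x).map ekey →
    x < mw ∨ (x = s.mc.widx ∧ (s.pc = .postR ∨ s.pc = .postV ∨ s.pc = .postM))
  memw2 : s.pc = .scanH ∨ s.pc = .scanS ∨ s.pc = .post →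
    ∀ x, Sum.inr j ∈ (slr x).map ekey → x < s.mc.widx
  hpost : s.pc = .postR → hasW (slr s.mc.widx) = true
  hwin : s.pc = .postV ∨ s.pc = .postM → s.win <+: slr s.mc.widx ∧ hasW s.win = true
  scan : s.pc = .scanS → ∀ hk : s.k < m, s.a ≤ H ⟨s.k, hk⟩ ∧ s.mc.ridx ⟨s.k, hk⟩ < s.a
  hq : s.pc = .scanH ∨ s.pc = .scanS ∨ s.pc = .post → hasW (slr s.mc.widx) = false →
    ∀ i ∈ s.toHelp, QQ slr (H i) (G i) i s.mc.widx

theorem WI.env {slr slr' : ℤ → List (Entry m n)} {mw mw' : ℤ} {H H' G G' : Fin m → ℤ} {j : Fin n}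
    {s : WState m n}
    (h : WI slr mw H G j s) (hp : ∀ x, slr x <+: slr' x) (hm : mw ≤ mw') (hH : ∀ i, H i ≤ H' i)
    (hmem : ∀ x, Sum.inr j ∈ (slr' x).map ekey → Sum.inr j ∈ (slr x).map ekey)
    (hq : ∀ i l, 0 ≤ l → l ≤ mw → hasW (slr' l) = false → QQ slr (H i) (G i) i l →
      QQ slr' (H' i) (G' i) i l) :
    WI slr' mw' H' G' j s := by
  refine ⟨h.mcv.ext hp, h.mcle.trans hm, ?_, fun hpc x hx => h.memw2 hpc x (hmem x hx),
    fun hpc => hasW_prefix (hp _) (h.hpost hpc), 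
    fun hpc => ⟨(h.hwin hpc).1.trans (hp _), (h.hwin hpc).2⟩, ?_, ?_⟩
  · intro x hx
    exact (h.memw x (hmem x hx)).imp (fun q => by omega) id
  · intro hpc hk
    have := h.scan hpc hk
    exact ⟨this.1.trans (hH _), this.2⟩
  · intro hpc hw i hi
    refine hq i _ h.mcv.lo h.mcle hw (h.hq hpc ?_ i hi)
    by_contra hc
    have := hasW_prefix (hp s.mc.widx) (by simpa using hc)
    simp [this] at hw

/-- The global invariant. -/
structure Inv (c : Config m n) (G : Fin m → ℤ) : Prop where
  nd : ∀ x, ((c.slr x).map ekey).Nodup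
  mv : Valid c.slr c.M
  top : ∀ y, c.slr y ≠ [] → y ≤ c.M.widx
  ri : ∀ i, RI c.slr c.M.widx (c.H i) (G i) i (c.rst i)
  wi : ∀ j, WI c.slr c.M.widx c.H G j (c.wst j)

theorem Inv.localR {c : Config m n} {G : Fin m → ℤ} (h : Inv c G) {i : Fin m} {s : RState m n}
    (hs : RI c.slr c.M.widx (c.H i) (G i) i s) : Inv (upR c i s) G := by
  refine ⟨h.nd, h.mv, h.top, ?_, h.wi⟩
  intro i'
  by_cases hi : i' = i
  · subst hi; simpa [upR] using hs
  · simpa [upR, hi] using h.ri i'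

theorem Inv.localW {c : Config m n} {G : Fin m → ℤ} (h : Inv c G) {j : Fin n} {s : WState m n}
    (hs : WI c.slr c.M.widx c.H G j s) : Inv (upW c j s) G := by
  refine ⟨h.nd, h.mv, h.top, h.ri, ?_⟩
  intro j'
  by_cases hi : j' = j
  · subst hi; simpa [upW] using hs
  · simpa [upW, hi] using h.wi j'

theorem Inv.localA {c : Config m n} {G : Fin m → ℤ} (h : Inv c G) {a : ℕ} {s : AState m n} :
    Inv (upA c a s) G := ⟨h.nd, h.mv, h.top, h.ri, h.wi⟩

theorem wmax_le (a b : MVal m) : a.widx ≤ (wmax a b).widx ∧ b.widx ≤ (wmax a b).widx := by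
  unfold wmax; split <;> constructor <;> omega

theorem Inv.setM {c : Config m n} {G : Fin m → ℤ} (h : Inv c G) {v : MVal m}
    (hv : Valid c.slr v) : Inv { c with M := wmax c.M v } G := by
  have hm := (wmax_le c.M v).1
  refine ⟨h.nd, ?_, fun y hy => (h.top y hy).trans hm, ?_, ?_⟩
  · show Valid c.slr (wmax c.M v)
    unfold wmax; split
    · exact hv
    · exact h.mv
  · intro i
    exact (h.ri i).env (fun x => List.prefix_rfl) hm (fun x hx => hx) (fun y hy => Or.inl hy)
  · intro j
    exact (h.wi j).env (fun x => List.prefix_rfl) hm (fun i => le_rfl) (fun x hx => hx)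
      (fun i l _ _ _ hq => hq)

/-! ### Local steps of readers -/

section readerSteps

variable {slr : ℤ → List (Entry m n)} {mw hi g : ℤ} {i : Fin m} {s : RState m n}

theorem RI.resp (h : RI slr mw hi g i s) (hpc : s.pc = .retNow) :
    RI slr mw hi g i { s with pc := .idle } := by
  obtain ⟨lsr, lval, mc, win, it, pc⟩ := s
  cases hpc
  obtain ⟨h1, h2, h3, h4, h5, h6, h7, h8, h9, h10, h11, h12, h13, h14, h15, h16, h17, h18, h19, h20,
    h21, h22⟩ := h
  simp [-List.mem_map] at h1 h2 h3 h4 h5 h6 h7 h8 h9 h10 h11 h12 h13 h14 h15 h16 h17 h18 h19 h20 h21 h22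
  constructor <;> try simp [-List.mem_map]
  all_goals first
    | omega
    | assumption
    | simp_all [-List.mem_map]

theorem RI.precheck (h : RI slr mw hi g i s) (hpc : s.pc = .precheck) :
    RI slr mw hi g i { s with win := slr s.lsr, pc := if hasW (slr s.lsr) then RPC.preM else RPC.retNow } := by
  obtain ⟨lsr, lval, mc, win, it, pc⟩ := s
  cases hpc
  obtain ⟨h1, h2, h3, h4, h5, h6, h7, h8, h9, h10, h11, h12, h13, h14, h15, h16, h17, h18, h19, h20,
    h21, h22⟩ := h
  simp [-List.mem_map] at h1 h2 h3 h4 h5 h6 h7 h8 h9 h10 h11 h12 h13 h14 h15 h16 h17 h18 h19 h20 h21 h22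
  by_cases hw : hasW (slr lsr) = true <;> simp only [hw] <;> constructor <;> simp_all [-List.mem_map]

theorem RI.helpVal (h : RI slr mw hi g i s) (hpc : s.pc = .helpVal) (v : Val) :
    RI slr mw hi g i { s with lval := v, pc := .retNow } := by
  obtain ⟨lsr, lval, mc, win, it, pc⟩ := s
  cases hpc
  obtain ⟨h1, h2, h3, h4, h5, h6, h7, h8, h9, h10, h11, h12, h13, h14, h15, h16, h17, h18, h19, h20,
    h21, h22⟩ := h
  simp [-List.mem_map] at h1 h2 h3 h4 h5 h6 h7 h8 h9 h10 h11 h12 h13 h14 h15 h16 h17 h18 h19 h20 h21 h22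
  constructor <;> try simp [-List.mem_map]
  all_goals first
    | omega
    | assumption
    | simp_all [-List.mem_map]

theorem RI.rSLR (h : RI slr mw hi g i s) (hpc : s.pc = .rSLR) :
    RI slr mw hi g i { s with win := slr s.lsr, pc := .gVal } := by
  obtain ⟨lsr, lval, mc, win, it, pc⟩ := s
  cases hpc
  obtain ⟨h1, h2, h3, h4, h5, h6, h7, h8, h9, h10, h11, h12, h13, h14, h15, h16, h17, h18, h19, h20,
    h21, h22⟩ := h
  simp [-List.mem_map] at h1 h2 h3 h4 h5 h6 h7 h8 h9 h10 h11 h12 h13 h14 h15 h16 h17 h18 h19 h20 h21 h22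
  constructor <;> try simp [-List.mem_map]
  all_goals first
    | omega
    | assumption
    | simp_all [-List.mem_map]

theorem RI.gVal (h : RI slr mw hi g i s) (hpc : s.pc = .gVal) (v : Val) :
    RI slr mw hi g i { s with lval := v, pc := .helpChk } := by
  obtain ⟨lsr, lval, mc, win, it, pc⟩ := s
  cases hpc
  obtain ⟨h1, h2, h3, h4, h5, h6, h7, h8, h9, h10, h11, h12, h13, h14, h15, h16, h17, h18, h19, h20,
    h21, h22⟩ := h
  simp [-List.mem_map] at h1 h2 h3 h4 h5 h6 h7 h8 h9 h10 h11 h12 h13 h14 h15 h16 h17 h18 h19 h20 h21 h22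
  constructor <;> try simp [-List.mem_map]
  all_goals first
    | omega
    | assumption
    | simp_all [-List.mem_map]

theorem RI.preM {M : MVal m} (hM : Valid slr M) (h : RI slr M.widx hi g i s)
    (hpc : s.pc = .preM) :
    RI slr M.widx hi g i { s with mc := M, pc := if M.widx = s.lsr then RPC.preHelp else RPC.loopM } := by
  obtain ⟨lsr, lval, mc, win, it, pc⟩ := s
  cases hpc
  obtain ⟨h1, h2, h3, h4, h5, h6, h7, h8, h9, h10, h11, h12, h13, h14, h15, h16, h17, h18, h19, h20,
    h21, h22⟩ := h
  simp [-List.mem_map] at h1 h2 h3 h4 h5 h6 h7 h8 h9 h10 h11 h12 h13 h14 h15 h16 h17 h18 h19 h20 h21 h22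
  by_cases hw : M.widx = lsr <;> simp only [hw] <;> constructor <;> simp_all [-List.mem_map]
  omega

theorem RI.loopM {M : MVal m} (hM : Valid slr M) (h : RI slr M.widx hi g i s)
    (hpc : s.pc = .loopM) :
    RI slr M.widx hi g i (if s.lsr < M.ridx i then
                { s with mc := M, it := s.it + 1, lsr := M.ridx i, pc := .helpVal }
              else
                { s with mc := M, it := s.it + 1, lsr := M.widx, pc := .annH }) := by
  obtain ⟨lsr, lval, mc, win, it, pc⟩ := s
  cases hpc
  obtain ⟨h1, h2, h3, h4, h5, h6, h7, h8, h9, h10, h11, h12, h13, h14, h15, h16, h17, h18, h19, h20,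
    h21, h22⟩ := h
  simp [-List.mem_map] at h1 h2 h3 h4 h5 h6 h7 h8 h9 h10 h11 h12 h13 h14 h15 h16 h17 h18 h19 h20 h21 h22
  have e1 := hM.rlt i
  have e2 := hM.rrec i
  have e3 := hM.rmax i
  by_cases hw : lsr < M.ridx i
  · have e4 : i ∈ readersOf (slr (M.ridx i)) := by
      rcases e2 with e2 | e2
      · omega
      · exact e2
    simp only [hw, if_true]
    constructor <;> try simp [-List.mem_map]
    all_goals first
      | omega
      | assumption
      | (intro x hx; have := h4 x hx; omega)
  · simp only [hw, if_false]
    constructor <;> try simp [-List.mem_map]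
    all_goals first
      | omega
      | assumption
      | (intro x hx; have := h4 x hx; omega)
      | skip
    intro y hy hg
    by_contra hc
    have := h20 y hy hg
    exact e3 y (by omega) (by omega) hy

theorem RI.preHelp (h : RI slr mw hi g i s) (hpc : s.pc = .preHelp) (hw : s.lsr < mw) :
    RI slr mw hi g i { s with pc := .loopM } := by
  obtain ⟨lsr, lval, mc, win, it, pc⟩ := s
  cases hpc
  obtain ⟨h1, h2, h3, h4, h5, h6, h7, h8, h9, h10, h11, h12, h13, h14, h15, h16, h17, h18, h19, h20,
    h21, h22⟩ := h
  simp [-List.mem_map] at h1 h2 h3 h4 h5 h6 h7 h8 h9 h10 h11 h12 h13 h14 h15 h16 h17 h18 h19 h20 h21 h22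
  constructor <;> try simp [-List.mem_map]
  all_goals first
    | omega
    | assumption
    | simp_all [-List.mem_map]

theorem RI.helpChk (h : RI slr mw hi g i s) (hpc : s.pc = .helpChk)
    (hw : hasW s.win = true → s.lsr < mw) :
    RI slr mw hi g i { s with pc := .loopEnd } := by
  obtain ⟨lsr, lval, mc, win, it, pc⟩ := s
  cases hpc
  obtain ⟨h1, h2, h3, h4, h5, h6, h7, h8, h9, h10, h11, h12, h13, h14, h15, h16, h17, h18, h19, h20,
    h21, h22⟩ := h
  simp [-List.mem_map] at h1 h2 h3 h4 h5 h6 h7 h8 h9 h10 h11 h12 h13 h14 h15 h16 h17 h18 h19 h20 h21 h22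
  constructor <;> try simp [-List.mem_map]
  all_goals first
    | omega
    | assumption
    | simp_all [-List.mem_map]

theorem RI.loopEnd (h : RI slr mw hi g i s) (hpc : s.pc = .loopEnd) :
    RI slr mw hi g i { s with pc := if i ∈ readersOf s.win then RPC.retNow else RPC.loopM } := by
  obtain ⟨lsr, lval, mc, win, it, pc⟩ := s
  cases hpc
  obtain ⟨h1, h2, h3, h4, h5, h6, h7, h8, h9, h10, h11, h12, h13, h14, h15, h16, h17, h18, h19, h20,
    h21, h22⟩ := h
  simp [-List.mem_map] at h1 h2 h3 h4 h5 h6 h7 h8 h9 h10 h11 h12 h13 h14 h15 h16 h17 h18 h19 h20 h21 h22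
  by_cases hw : i ∈ readersOf win
  · have := readersOf_prefix h8 hw
    simp only [hw, if_true]
    constructor <;> try simp [-List.mem_map]
    all_goals first
      | omega
      | assumption
      | exact Or.inl ⟨this, h16⟩
  · have hh : hasW win = true := hasW_of_mem (by simpa using h11) hw
    have hn := readersOf_prefix_eq h8 hh
    simp only [hw, if_false]
    constructor <;> try simp [-List.mem_map]
    all_goals first
      | omega
      | assumption
      | exact h13 hh
      | skip
    intro y hy hg
    have := h21 y hy hg
    rcases this.lt_or_eq with h | h
    · exact h
    · subst h; rw [hn] at hy; exact absurd hy hw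

theorem RI.annH (h : RI slr mw hi g i s) (hpc : s.pc = .annH) :
    RI slr mw s.lsr g i { s with pc := .wSLR } := by
  obtain ⟨lsr, lval, mc, win, it, pc⟩ := s
  cases hpc
  obtain ⟨h1, h2, h3, h4, h5, h6, h7, h8, h9, h10, h11, h12, h13, h14, h15, h16, h17, h18, h19, h20,
    h21, h22⟩ := h
  simp [-List.mem_map] at h1 h2 h3 h4 h5 h6 h7 h8 h9 h10 h11 h12 h13 h14 h15 h16 h17 h18 h19 h20 h21 h22
  constructor <;> try simp [-List.mem_map]
  all_goals first
    | omega
    | assumption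
    | simp_all [-List.mem_map]

theorem RI.inv (h : RI slr mw hi g i s) (h0 : 0 ≤ mw) (hpc : s.pc = .idle) :
    RI slr mw hi s.lsr i { s with it := 0, pc := if 0 ≤ s.lsr then RPC.precheck else RPC.loopM } := by
  obtain ⟨lsr, lval, mc, win, it, pc⟩ := s
  cases hpc
  obtain ⟨h1, h2, h3, h4, h5, h6, h7, h8, h9, h10, h11, h12, h13, h14, h15, h16, h17, h18, h19, h20,
    h21, h22⟩ := h
  simp [-List.mem_map] at h1 h2 h3 h4 h5 h6 h7 h8 h9 h10 h11 h12 h13 h14 h15 h16 h17 h18 h19 h20 h21 h22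
  have e : lsr = -1 ∨ i ∈ readersOf (slr lsr) := by
    rcases h18 with h | h
    · exact Or.inr h.1
    · rw [h.2]; exact h14
  have e2 : ∀ y, i ∈ readersOf (slr y) → lsr < y → hi ≤ y := fun y _ hy => by omega
  by_cases hw : 0 ≤ lsr
  · simp only [hw, if_true]
    constructor <;> try simp [-List.mem_map]
    all_goals first
      | omega
      | assumption
  · simp only [hw, if_false]
    constructor <;> try simp [-List.mem_map]
    all_goals first
      | omega
      | assumption

end readerSteps

/-! ### Appending to a sliding register -/

/-- Facts about writing a fresh entry `e` to the sliding register `x`. -/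
structure App (slr slr' : ℤ → List (Entry m n)) (x : ℤ) (e : Entry m n) : Prop where
  at_x : slr' x = slr x ++ [e]
  ne_x : ∀ y, y ≠ x → slr' y = slr y
  fresh : ekey e ∉ (slr x).map ekey

theorem App.pre {slr slr' : ℤ → List (Entry m n)} {x : ℤ} {e : Entry m n}
    (h : App slr slr' x e) (y : ℤ) : slr y <+: slr' y := by
  by_cases hy : y = x
  · subst hy; rw [h.at_x]; exact List.prefix_append _ _
  · rw [h.ne_x y hy]

theorem App.mem {slr slr' : ℤ → List (Entry m n)} {x : ℤ} {e : Entry m n}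
    (h : App slr slr' x e) {y : ℤ} {k : Fin m ⊕ Fin n} (hk : k ∈ (slr' y).map ekey) :
    k ∈ (slr y).map ekey ∨ (y = x ∧ k = ekey e) := by
  by_cases hy : y = x
  · subst hy
    rw [h.at_x, List.map_append, List.mem_append] at hk
    refine hk.imp id fun q => ⟨rfl, by simpa using q⟩
  · rw [h.ne_x y hy] at hk
    exact Or.inl hk

theorem App.recd {slr slr' : ℤ → List (Entry m n)} {x : ℤ} {e : Entry m n}
    (h : App slr slr' x e) {y : ℤ} {i : Fin m} (hi : i ∈ readersOf (slr' y)) 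
    (hn : i ∉ readersOf (slr y)) :
    y = x ∧ hasW (slr x) = false ∧ ((e = .r i) ∨
      (∃ j v h, e = .w j v h ∧ i ∈ h ∧ i ∉ preW (slr' x) ∧ hasW (slr' x) = true)) := by
  by_cases hy : y = x
  · subst hy
    rw [h.at_x] at hi ⊢
    exact ⟨rfl, readersOf_append hi hn⟩
  · rw [h.ne_x y hy] at hi
    exact absurd hi hn

theorem App.mk' {slr : ℤ → List (Entry m n)} {x : ℤ} {e : Entry m n}
    (nd : ((slr x).map ekey).Nodup) (fresh : ekey e ∉ (slr x).map ekey) :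
    App slr (Function.update slr x (slide (m + n) (slr x) e)) x e := by
  refine ⟨?_, fun y hy => by simp [hy], fresh⟩
  rw [Function.update_self]
  apply slide_eq
  rw [List.map_append, List.nodup_append]
  refine ⟨nd, by simp, ?_⟩
  rintro a ha b hb rfl
  simp at hb
  subst hb
  exact fresh ha

theorem App.nd {slr slr' : ℤ → List (Entry m n)} {x : ℤ} {e : Entry m n}
    (h : App slr slr' x e) (nd : ∀ y, ((slr y).map ekey).Nodup) (y : ℤ) :
    ((slr' y).map ekey).Nodup := by
  by_cases hy : y = x
  · subst hy
    rw [h.at_x, List.map_append, List.nodup_append]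
    refine ⟨nd _, by simp, ?_⟩
    rintro a ha b hb rfl
    simp at hb
    subst hb
    exact h.fresh ha
  · rw [h.ne_x y hy]; exact nd y

theorem App.qq {slr slr' : ℤ → List (Entry m n)} {x : ℤ} {e : Entry m n}
    (h : App slr slr' x e) {M : MVal m} (hM : Valid slr M) (hx : -1 ≤ x) (hx' : x ≤ M.widx)
    {hi g : ℤ} {i : Fin m} {l : ℤ} (hl : 0 ≤ l) (hl' : l ≤ M.widx) (hw : hasW (slr' l) = false)
    (hq : QQ slr hi g i l) : QQ slr' hi g i l := by
  rcases hq with hq | ⟨h1, h2⟩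
  · exact Or.inl (readersOf_prefix (h.pre l) hq)
  · by_cases hr : i ∈ readersOf (slr' l)
    · exact Or.inl hr
    · refine Or.inr ⟨fun y hy => ?_, h2⟩
      by_cases hn : i ∈ readersOf (slr y)
      · exact h1 y hn
      · exfalso
        obtain ⟨rfl, hf, -⟩ := h.recd hy hn
        have e1 : ¬ y < M.widx := fun q => by simp [hM.hw y hx q] at hf
        have e2 : ¬ l < M.widx := fun q => by
          simp [hasW_prefix (h.pre l) (hM.hw l (by omega) q)] at hw
        have : y = l := by omega
        subst this
        exact hr hy

theorem App.rec_top {slr slr' : ℤ → List (Entry m n)} {x : ℤ} {e : Entry m n}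
    (h : App slr slr' x e) {M : MVal m} (hM : Valid slr M) (hx : -1 ≤ x) (hx' : x ≤ M.widx)
    (i : Fin m) (y : ℤ) (hi : i ∈ readersOf (slr' y)) : i ∈ readersOf (slr y) ∨ y = M.widx := by
  by_cases hn : i ∈ readersOf (slr y)
  · exact Or.inl hn
  · right
    obtain ⟨rfl, hf, -⟩ := h.recd hi hn
    have e1 : ¬ y < M.widx := fun q => by simp [hM.hw y hx q] at hf
    omega

theorem App.top {slr slr' : ℤ → List (Entry m n)} {x : ℤ} {e : Entry m n}
    (h : App slr slr' x e) {mw : ℤ} (ht : ∀ y, slr y ≠ [] → y ≤ mw) (hx' : x ≤ mw) (y : ℤ)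
    (hy : slr' y ≠ []) : y ≤ mw := by
  by_cases hyx : y = x
  · omega
  · rw [h.ne_x y hyx] at hy; exact ht y hy

theorem Inv.appR {c : Config m n} {G : Fin m → ℤ} (h : Inv c G) {i : Fin m}
    (hpc : (c.rst i).pc = .wSLR) :
    App c.slr (Function.update c.slr (c.rst i).lsr
      (slide (m + n) (c.slr (c.rst i).lsr) (.r i))) (c.rst i).lsr (.r i) := by
  apply App.mk' (h.nd _)
  intro hk
  have := (h.ri i).mem_lt (Or.inr hpc) _ hk
  omega

theorem Inv.appW {c : Config m n} {G : Fin m → ℤ} (h : Inv c G) {j : Fin n}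
    (hpc : (c.wst j).pc = .post) (v : Val) (s : Finset (Fin m)) :
    App c.slr (Function.update c.slr (c.wst j).mc.widx
      (slide (m + n) (c.slr (c.wst j).mc.widx) (.w j v s))) (c.wst j).mc.widx (.w j v s) := by
  apply App.mk' (h.nd _)
  intro hk
  have := (h.wi j).memw2 (Or.inr (Or.inr hpc)) _ hk
  omega

theorem Inv.writeR {c : Config m n} {G : Fin m → ℤ} (h : Inv c G) {i : Fin m}
    {slr' : ℤ → List (Entry m n)} (hpc : (c.rst i).pc = .wSLR)
    (ha : App c.slr slr' (c.rst i).lsr (.r i)) :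
    Inv { upR c i { c.rst i with pc := .rSLR } with slr := slr' } G := by
  have hi := h.ri i
  refine ⟨ha.nd h.nd, h.mv.ext ha.pre, ha.top h.top hi.le, ?_, ?_⟩
  · intro i'
    by_cases hii : i' = i
    · subst hii
      have hrt := ha.rec_top h.mv hi.lo hi.le i'
      have e1 := hi.le
      have e2 := hi.hle
      have e3 := hi.glt (by simp [hpc])
      show RI slr' c.M.widx (c.H i') (G i') i'
        (Function.update c.rst i' { c.rst i' with pc := .rSLR } i')
      rw [Function.update_self]
      constructor <;> try simp [-List.mem_map]
      · exact hi.lo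
      · exact hi.le
      · exact hi.hle
      · intro x hx
        rcases ha.mem hx with hx | hx
        · exact hi.mem_le x hx
        · exact hx.1.le
      · exact hi.mcv.ext ha.pre
      · exact hi.mcw (by simp [hpc])
      · rw [ha.at_x]; simp [ekey]
      · exact hi.grec.imp id (readersOf_prefix (ha.pre _))
      · exact hi.gle
      · exact e3
      · intro y hy hg
        rcases hrt y hy with hy | hy
        · exact hi.ka (by simp [hpc]) y hy hg
        · omega
      · intro y hy hg
        rcases hrt y hy with hy | hy
        · exact hi.hr y hy hg
        · omega
    · have := (h.ri i').env ha.pre le_rfl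
        (fun x hx => (ha.mem hx).resolve_right (fun q => hii (by simpa [ekey] using q.2)))
        (ha.rec_top h.mv hi.lo hi.le i')
      simpa [upR, hii] using this
  · intro j
    exact (h.wi j).env ha.pre le_rfl (fun _ => le_rfl)
      (fun x hx => (ha.mem hx).resolve_right (fun q => by simpa [ekey] using q.2))
      (fun i' l h1 h2 h3 h4 => ha.qq h.mv hi.lo hi.le h1 h2 h3 h4)

theorem Inv.writeW {c : Config m n} {G : Fin m → ℤ} (h : Inv c G) {j : Fin n}
    {slr' : ℤ → List (Entry m n)} {v : Val} {s : Finset (Fin m)} (hpc : (c.wst j).pc = .post)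
    (ha : App c.slr slr' (c.wst j).mc.widx (.w j v s)) :
    Inv { upW c j { c.wst j with pc := .postR } with slr := slr' } G := by
  have hj := h.wi j
  have h0 := hj.mcv.lo
  refine ⟨ha.nd h.nd, h.mv.ext ha.pre, ha.top h.top hj.mcle, ?_, ?_⟩
  · intro i
    exact (h.ri i).env ha.pre le_rfl
      (fun x hx => (ha.mem hx).resolve_right (fun q => by simpa [ekey] using q.2))
      (ha.rec_top h.mv (by omega) hj.mcle i)
  · intro j'
    by_cases hjj : j' = j
    · subst hjj
      show WI slr' c.M.widx c.H G j'
        (Function.update c.wst j' { c.wst j' with pc := .postR } j')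
      rw [Function.update_self]
      constructor <;> try simp [-List.mem_map]
      · exact hj.mcv.ext ha.pre
      · exact hj.mcle
      · intro x hx
        rcases ha.mem hx with hx | hx
        · have := hj.memw x hx
          simp [hpc] at this
          exact Or.inl this
        · exact Or.inr hx.1
      · rw [ha.at_x]; simp [hasW, Entry.isW]
    · have := (h.wi j').env (H' := c.H) (G' := G) ha.pre le_rfl (fun _ => le_rfl)
        (fun x hx => (ha.mem hx).resolve_right (fun q => hjj (by simpa [ekey] using q.2)))
        (fun i' l h1 h2 h3 h4 => ha.qq h.mv (by omega) hj.mcle h1 h2 h3 h4)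
      simpa [upW, hjj] using this

theorem Inv.writeH {c : Config m n} {G : Fin m → ℤ} (h : Inv c G) {i : Fin m}
    (hpc : (c.rst i).pc = .annH) :
    Inv { upR c i { c.rst i with pc := .wSLR } with
      H := Function.update c.H i (c.rst i).lsr } G := by
  have hi := h.ri i
  refine ⟨h.nd, h.mv, h.top, ?_, ?_⟩
  · intro i'
    by_cases hii : i' = i
    · subst hii
      simpa [upR] using hi.annH hpc
    · simpa [upR, hii] using h.ri i'
  · intro j
    have hH : ∀ i', c.H i' ≤ Function.update c.H i (c.rst i).lsr i' := by
      intro i'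
      by_cases hii : i' = i
      · subst hii; simpa using hi.hle
      · simp [hii]
    refine (h.wi j).env (fun _ => List.prefix_rfl) le_rfl hH (fun x hx => hx) ?_
    intro i' l _ _ _ hq
    exact hq.imp id fun q => ⟨q.1, q.2.trans_le (hH i')⟩

theorem Inv.invR {c : Config m n} {G : Fin m → ℤ} (h : Inv c G) {i : Fin m}
    (hpc : (c.rst i).pc = .idle) :
    Inv (upR c i { c.rst i with it := 0, pc := if 0 ≤ (c.rst i).lsr then RPC.precheck else RPC.loopM })
      (Function.update G i (c.rst i).lsr) := by
  have hi := h.ri i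
  refine ⟨h.nd, h.mv, h.top, ?_, ?_⟩
  · intro i'
    by_cases hii : i' = i
    · subst hii
      simpa [upR] using hi.inv h.mv.lo hpc
    · simpa [upR, hii] using h.ri i'
  · intro j
    refine (h.wi j).env (fun _ => List.prefix_rfl) le_rfl (fun _ => le_rfl) (fun x hx => hx) ?_
    intro i' l _ _ _ hq
    by_cases hii : i' = i
    · subst hii
      rcases hq with hq | hq
      · exact Or.inl hq
      · exfalso
        rcases hi.fin (Or.inl hpc) with q | q
        · have := hq.1 _ q.1; omega
        · omega
    · simpa [upR, hii] using hq

theorem Inv.scanS {c : Config m n} {G : Fin m → ℤ} (h : Inv c G) {j : Fin n}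
    (hpc : (c.wst j).pc = .scanS) (hk : (c.wst j).k < m)
    (hw : hasW (c.slr (c.wst j).mc.widx) = false) :
    QQ c.slr (c.H ⟨(c.wst j).k, hk⟩) (G ⟨(c.wst j).k, hk⟩) ⟨(c.wst j).k, hk⟩
      (c.wst j).mc.widx := by
  have hj := h.wi j
  have hs := hj.scan hpc hk
  generalize (⟨(c.wst j).k, hk⟩ : Fin m) = i at *
  have hi := h.ri i
  have e1 := hj.mcle
  have e2 := hj.mcv.lo
  have e3 : ¬ (c.wst j).mc.widx < c.M.widx := fun q => by simp [h.mv.hw _ (by omega) q] at hw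
  by_cases hr : i ∈ readersOf (c.slr (c.wst j).mc.widx)
  · exact Or.inl hr
  right
  have hR : ∀ y, i ∈ readersOf (c.slr y) → y ≤ (c.wst j).mc.ridx i := by
    intro y hy
    by_contra hc
    have t1 : y ≤ c.M.widx := h.top y (by intro q; simp [q, readersOf, preW, firstW] at hy)
    have t2 : y ≠ (c.wst j).mc.widx := by rintro rfl; exact hr hy
    exact hj.mcv.rmax i y (by omega) (by omega) hy
  have hlo := hj.mcv.rlo i
  have hg : G i ≤ (c.wst j).mc.ridx i := by
    rcases hi.grec with q | q
    · omega
    · exact hR _ q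
  refine ⟨?_, by omega⟩
  intro y hy
  by_contra hc
  have := hi.hr y hy (by omega)
  have := hR y hy
  omega

/-! ### Local steps of writers -/

section writerSteps

variable {slr : ℤ → List (Entry m n)} {mw : ℤ} {H G : Fin m → ℤ} {j : Fin n} {s : WState m n}

theorem WI.inv (h : WI slr mw H G j s) (hpc : s.pc = .idle) (v : Val) :
    WI slr mw H G j { s with v := v, pc := .readM } := by
  obtain ⟨h1, h2, h3, h4, h5, h6, h7, h8⟩ := h
  simp [hpc, -List.mem_map] at h3
  constructor <;> try simp [-List.mem_map]
  all_goals assumption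

theorem WI.resp (h : WI slr mw H G j s) (hpc : s.pc = .wret) :
    WI slr mw H G j { s with pc := .idle } := by
  obtain ⟨h1, h2, h3, h4, h5, h6, h7, h8⟩ := h
  simp [hpc, -List.mem_map] at h3
  constructor <;> try simp [-List.mem_map]
  all_goals assumption

theorem WI.readM {M : MVal m} (hM : Valid slr M) (h : WI slr M.widx H G j s)
    (hpc : s.pc = .readM) :
    WI slr M.widx H G j { s with mc := M, toHelp := ∅, k := 0, pc := .scanH } := by
  obtain ⟨h1, h2, h3, h4, h5, h6, h7, h8⟩ := h
  simp [hpc, -List.mem_map] at h3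
  constructor <;> try simp [-List.mem_map]
  all_goals assumption

theorem WI.hread (h : WI slr mw H G j s) (hpc : s.pc = .scanH) (k : Fin m) (hk : (k : ℕ) = s.k) :
    WI slr mw H G j (if s.mc.ridx k < H k then { s with a := H k, pc := .scanS }
                    else { s with k := s.k + 1 }) := by
  obtain ⟨h1, h2, h3, h4, h5, h6, h7, h8⟩ := h
  simp [hpc, -List.mem_map] at h3 h4 h8
  split
  · rename_i hlt
    constructor <;> try simp [-List.mem_map]
    all_goals first
      | assumption
      | skip
    intro hk'
    have : (⟨s.k, hk'⟩ : Fin m) = k := by ext; simp [hk]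
    rw [this]
    exact ⟨le_rfl, hlt⟩
  · constructor <;> simp [hpc, -List.mem_map]
    all_goals assumption

theorem WI.scanDone (h : WI slr mw H G j s) (hpc : s.pc = .scanH) :
    WI slr mw H G j { s with pc := .post } := by
  obtain ⟨h1, h2, h3, h4, h5, h6, h7, h8⟩ := h
  simp [hpc, -List.mem_map] at h3 h4 h8
  constructor <;> try simp [-List.mem_map]
  all_goals assumption

theorem WI.scanNext (h : WI slr mw H G j s) (hpc : s.pc = .scanS) (T : Finset (Fin m)) (k : ℕ)
    (hT : hasW (slr s.mc.widx) = false → ∀ i ∈ T, i ∉ s.toHelp → QQ slr (H i) (G i) i s.mc.widx) :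
    WI slr mw H G j { s with toHelp := T, k := k, pc := .scanH } := by
  obtain ⟨h1, h2, h3, h4, h5, h6, h7, h8⟩ := h
  simp [hpc, -List.mem_map] at h3 h4 h8
  constructor <;> try simp [-List.mem_map]
  all_goals first
    | assumption
    | skip
  intro hw i hi
  by_cases hh : i ∈ s.toHelp
  · exact h8 hw i hh
  · exact hT hw i hi hh

theorem WI.postR (h : WI slr mw H G j s) (hpc : s.pc = .postR) :
    WI slr mw H G j { s with win := slr s.mc.widx, pc := .postV } := by
  obtain ⟨h1, h2, h3, h4, h5, h6, h7, h8⟩ := h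
  simp [hpc, -List.mem_map] at h3 h5
  constructor <;> try simp [-List.mem_map]
  all_goals assumption

theorem WI.postV (h : WI slr mw H G j s) (hpc : s.pc = .postV) (v : Val) :
    WI slr mw H G j { s with val := v, pc := .postM } := by
  obtain ⟨h1, h2, h3, h4, h5, h6, h7, h8⟩ := h
  simp [hpc, -List.mem_map] at h3 h6
  constructor <;> try simp [-List.mem_map]
  all_goals assumption

theorem WI.postM (h : WI slr mw H G j s) (hpc : s.pc = .postM) (hw : s.mc.widx < mw) :
    WI slr mw H G j { s with pc := .wret } := by
  obtain ⟨h1, h2, h3, h4, h5, h6, h7, h8⟩ := h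
  constructor <;> try simp [-List.mem_map]
  · assumption
  · assumption
  · intro x hx
    rcases h3 x hx with q | q
    · exact q
    · omega

end writerSteps

/-! ### Every step preserves the invariant -/

/-- Update of the ghost variable recording `lsr` at the last invocation of a READ. -/
def gstep (c : Config m n) (l : Lbl m n) (G : Fin m → ℤ) : Fin m → ℤ :=
  match l with
  | .invRead i => Function.update G i (c.rst i).lsr
  | _ => G

theorem Inv.step {c c' : Config m n} {l : Lbl m n} {G : Fin m → ℤ} (h : Inv c G)
    (hs : Step c l c') : Inv c' (gstep c l G) := by
  cases l with
  | invRead i =>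
    obtain ⟨hpc, rfl⟩ := hs
    exact h.invR hpc
  | respRead i v =>
    obtain ⟨hpc, -, rfl⟩ := hs
    exact h.localR ((h.ri i).resp hpc)
  | invWrite j v =>
    obtain ⟨hpc, rfl⟩ := hs
    exact h.localW ((h.wi j).inv hpc v)
  | respWrite j =>
    obtain ⟨hpc, rfl⟩ := hs
    exact h.localW ((h.wi j).resp hpc)
  | invAudit a =>
    obtain ⟨hpc, rfl⟩ := hs
    exact h.localA
  | respAudit a A =>
    obtain ⟨hpc, -, rfl⟩ := hs
    exact h.localA
  | slrRead p x win =>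
    obtain ⟨rfl, hs⟩ := hs
    cases p with
    | rdr i =>
      rcases hs with ⟨hpc, rfl, rfl⟩ | ⟨hpc, rfl, rfl⟩ | ⟨hpc, rfl, rfl⟩ | ⟨hpc, rfl, rfl⟩
      · exact h.localR ((h.ri i).precheck hpc)
      · exact h.localR ((h.ri i).helpVal hpc _)
      · exact h.localR ((h.ri i).rSLR hpc)
      · exact h.localR ((h.ri i).gVal hpc _)
    | wtr j =>
      rcases hs with ⟨hpc, rfl, hk, rfl⟩ | ⟨hpc, rfl, rfl⟩ | ⟨hpc, rfl, rfl⟩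
      · refine h.localW ((h.wi j).scanNext hpc _ _ ?_)
        intro hw i hi hn
        split at hi
        · exact absurd hi hn
        · rcases Finset.mem_insert.1 hi with rfl | hi
          · exact h.scanS hpc hk hw
          · exact absurd hi hn
      · exact h.localW ((h.wi j).postR hpc)
      · exact h.localW ((h.wi j).postV hpc _)
    | adt a =>
      rcases hs with ⟨hpc, rfl, rfl⟩ | ⟨hpc, rfl, rfl⟩
      · exact h.localA
      · exact h.localA
  | slrWrite p x e =>
    cases p with
    | rdr i =>
      obtain ⟨hpc, rfl, rfl, rfl⟩ := hs
      exact h.writeR hpc (h.appR hpc)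
    | wtr j =>
      obtain ⟨hpc, rfl, rfl, rfl⟩ := hs
      exact h.writeW hpc (h.appW hpc _ _)
    | adt a => exact hs.elim
  | mRead p v =>
    obtain ⟨rfl, hs⟩ := hs
    cases p with
    | rdr i =>
      rcases hs with ⟨hpc, rfl⟩ | ⟨hpc, rfl⟩
      · exact h.localR ((h.ri i).preM h.mv hpc)
      · exact h.localR ((h.ri i).loopM h.mv hpc)
    | wtr j =>
      obtain ⟨hpc, rfl⟩ := hs
      exact h.localW ((h.wi j).readM h.mv hpc)
    | adt a =>
      obtain ⟨hpc, rfl⟩ := hs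
      exact h.localA
  | mWrite p v =>
    cases p with
    | rdr i =>
      have hi := h.ri i
      rcases hs with ⟨hpc, rfl, rfl⟩ | ⟨hpc, hw, rfl, rfl⟩
      · have hv := hi.mcv.mArg (lv := (c.rst i).lval) (hi.mcw (by simp [hpc]))
          (hi.win (by simp [hpc])) (hi.hasw (by simp [hpc]))
        have h' := h.setM hv
        refine h'.localR ((h'.ri i).preHelp hpc ?_)
        have := (wmax_le c.M (mArg (c.rst i).mc (c.rst i).win (c.rst i).lsr (c.rst i).lval)).2
        simp only [mArg] at this ⊢
        omega
      · have hv := hi.mcv.mArg (lv := (c.rst i).lval) (hi.mcw (by simp [hpc]))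
          (hi.win (by simp [hpc])) hw
        have h' := h.setM hv
        refine h'.localR ((h'.ri i).helpChk hpc fun _ => ?_)
        have := (wmax_le c.M (mArg (c.rst i).mc (c.rst i).win (c.rst i).lsr (c.rst i).lval)).2
        simp only [mArg] at this ⊢
        omega
    | wtr j =>
      have hj := h.wi j
      obtain ⟨hpc, rfl, rfl⟩ := hs
      have hw := hj.hwin (Or.inr hpc)
      have hv := hj.mcv.mArg (lv := (c.wst j).val) rfl hw.1 hw.2
      have h' := h.setM hv
      refine h'.localW ((h'.wi j).postM hpc ?_)
      have := (wmax_le c.M (mArg (c.wst j).mc (c.wst j).win (c.wst j).mc.widx (c.wst j).val)).2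
      simp only [mArg] at this ⊢
      omega
    | adt a => exact hs.elim
  | hRead j k a =>
    obtain ⟨hpc, hk, rfl, rfl⟩ := hs
    exact h.localW ((h.wi j).hread hpc k hk)
  | hWrite i x =>
    obtain ⟨hpc, rfl, rfl⟩ := hs
    exact h.writeH hpc
  | tau p =>
    cases p with
    | rdr i =>
      rcases hs with ⟨hpc, hw, rfl⟩ | ⟨hpc, rfl⟩
      · exact h.localR ((h.ri i).helpChk hpc (by simp [hw]))
      · exact h.localR ((h.ri i).loopEnd hpc)
    | wtr j =>
      obtain ⟨hpc, -, rfl⟩ := hs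
      exact h.localW ((h.wi j).scanDone hpc)
    | adt a => exact hs.elim

theorem Step.slr_cases {c c' : Config m n} {l : Lbl m n} {G : Fin m → ℤ} (h : Inv c G)
    (hs : Step c l c') : c'.slr = c.slr ∨
      (∃ i, (c.rst i).pc = .wSLR ∧ l = .slrWrite (.rdr i) (c.rst i).lsr (.r i) ∧
        App c.slr c'.slr (c.rst i).lsr (.r i)) ∨
      (∃ j, (c.wst j).pc = .post ∧ 
        App c.slr c'.slr (c.wst j).mc.widx (.w j (c.wst j).v (c.wst j).toHelp)) := by
  cases l with
  | invRead i => obtain ⟨hpc, rfl⟩ := hs; exact Or.inl rfl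
  | respRead i v => obtain ⟨hpc, -, rfl⟩ := hs; exact Or.inl rfl
  | invWrite j v => obtain ⟨hpc, rfl⟩ := hs; exact Or.inl rfl
  | respWrite j => obtain ⟨hpc, rfl⟩ := hs; exact Or.inl rfl
  | invAudit a => obtain ⟨hpc, rfl⟩ := hs; exact Or.inl rfl
  | respAudit a A => obtain ⟨hpc, -, rfl⟩ := hs; exact Or.inl rfl
  | slrRead p x win =>
    left
    obtain ⟨rfl, hs⟩ := hs
    cases p with
    | rdr i => rcases hs with ⟨_, _, rfl⟩ | ⟨_, _, rfl⟩ | ⟨_, _, rfl⟩ | ⟨_, _, rfl⟩ <;> rfl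
    | wtr j => rcases hs with ⟨_, _, _, rfl⟩ | ⟨_, _, rfl⟩ | ⟨_, _, rfl⟩ <;> rfl
    | adt a => rcases hs with ⟨_, _, rfl⟩ | ⟨_, _, rfl⟩ <;> rfl
  | slrWrite p x e =>
    right
    cases p with
    | rdr i =>
      obtain ⟨hpc, rfl, rfl, rfl⟩ := hs
      exact Or.inl ⟨i, hpc, rfl, h.appR hpc⟩
    | wtr j =>
      obtain ⟨hpc, rfl, rfl, rfl⟩ := hs
      exact Or.inr ⟨j, hpc, h.appW hpc _ _⟩
    | adt a => exact hs.elim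
  | mRead p v =>
    left
    obtain ⟨rfl, hs⟩ := hs
    cases p with
    | rdr i => rcases hs with ⟨_, rfl⟩ | ⟨_, rfl⟩ <;> rfl
    | wtr j => obtain ⟨_, rfl⟩ := hs; rfl
    | adt a => obtain ⟨_, rfl⟩ := hs; rfl
  | mWrite p v =>
    left
    cases p with
    | rdr i => rcases hs with ⟨_, _, rfl⟩ | ⟨_, _, _, rfl⟩ <;> rfl
    | wtr j => obtain ⟨_, _, rfl⟩ := hs; rfl
    | adt a => exact hs.elim
  | hRead j k a => obtain ⟨_, _, _, rfl⟩ := hs; exact Or.inl rfl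
  | hWrite i x => obtain ⟨_, _, rfl⟩ := hs; exact Or.inl rfl
  | tau p =>
    left
    cases p with
    | rdr i => rcases hs with ⟨_, _, rfl⟩ | ⟨_, rfl⟩ <;> rfl
    | wtr j => obtain ⟨_, _, rfl⟩ := hs; rfl
    | adt a => exact hs.elim

theorem Step.pre {c c' : Config m n} {l : Lbl m n} {G : Fin m → ℤ} (h : Inv c G)
    (hs : Step c l c') (x : ℤ) : c.slr x <+: c'.slr x := by
  rcases Step.slr_cases h hs with q | ⟨i, _, _, q⟩ | ⟨j, _, q⟩
  · rw [q]
  · exact q.pre x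
  · exact q.pre x

/-- A new record of reader `i` is made during a READ of `p_i` that has no record yet. -/
theorem Step.newRec {c c' : Config m n} {l : Lbl m n} {G : Fin m → ℤ} (h : Inv c G)
    (hs : Step c l c') {i : Fin m} {x : ℤ} (hi : i ∈ readersOf (c'.slr x))
    (hn : i ∉ readersOf (c.slr x)) :
    (c.rst i).pc ≠ .idle ∧ G i < x ∧ (∀ z, i ∈ readersOf (c.slr z) → z ≤ G i) ∧
      (l = .slrWrite (.rdr i) x (.r i) ∨ (i ∉ preW (c'.slr x) ∧ hasW (c'.slr x) = true)) := by
  rcases Step.slr_cases h hs with q | ⟨i', hpc, hl, q⟩ | ⟨j, hpc, q⟩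
  · rw [q] at hi; exact absurd hi hn
  · obtain ⟨rfl, hw, q⟩ := q.recd hi hn
    simp only [Entry.r.injEq, reduceCtorEq, false_and, exists_false, or_false] at q
    subst q
    have hi' := h.ri i'
    have e1 := hi'.le
    have e2 := hi'.lo
    have e3 : ¬ (c.rst i').lsr < c.M.widx := fun q => by simp [h.mv.hw _ e2 q] at hw
    refine ⟨by simp [hpc], hi'.glt (by simp [hpc]), ?_, Or.inl hl⟩
    intro z hz
    by_contra hc
    have t1 := hi'.ka (by simp [hpc]) z hz (by omega)
    have t2 : z ≤ c.M.widx := h.top z (by intro q; simp [q, readersOf, preW, firstW] at hz)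
    have : z = (c.rst i').lsr := by omega
    rw [this] at hz
    exact hn hz
  · obtain ⟨rfl, hw, q⟩ := q.recd hi hn
    simp only [reduceCtorEq, false_or] at q
    obtain ⟨j', v, s, he, hmem, hp, hw'⟩ := q
    cases he
    have hj := h.wi j
    have e1 := hj.mcle
    have e2 := hj.mcv.lo
    have e3 : ¬ (c.wst j).mc.widx < c.M.widx := fun q => by simp [h.mv.hw _ (by omega) q] at hw
    have hq := (hj.hq (by simp [hpc]) hw i hmem).resolve_left hn
    have hi' := h.ri i
    have e4 := hi'.le
    have e5 := hi'.hle
    refine ⟨?_, by omega, hq.1, Or.inr ⟨hp, hw'⟩⟩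
    intro hpi
    rcases hi'.fin (Or.inl hpi) with q | q
    · have := hq.1 _ q.1; omega
    · omega

theorem inv_init (m n : ℕ) (v0 : Val) (j0 : Fin n) : Inv (init m n v0 j0) (fun _ => -1) := by
  have hr : ∀ (y : ℤ) (i : Fin m), i ∉ readersOf ((init m n v0 j0).slr y) := by
    intro y i
    simp only [init]
    split <;> simp [readersOf, preW, firstW]
  have hv : Valid (init m n v0 j0).slr ⟨0, fun _ => -1, ∅⟩ := by
    constructor
    · simp
    · intro y h1 h2
      have : y = -1 := by simp at h2; omega
      simp [init, this, hasW, Entry.isW]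
    · simp
    · simp
    · simp
    · intro j y _ _; exact hr y j
  refine ⟨?_, hv, ?_, ?_, ?_⟩
  · intro x; simp only [init]; split <;> simp
  · intro y hy
    simp only [init] at hy ⊢
    split at hy <;> simp_all
  · intro i
    have hm : ∀ x, Sum.inl i ∉ ((init m n v0 j0).slr x).map ekey := by
      intro x; simp only [init]; split <;> simp [ekey]
    constructor
    case mcv => exact hv
    case mem_le => intro x hx; exact absurd hx (hm x)
    case mem_lt => intro _ x hx; exact absurd hx (hm x)
    case hr => intro y hy; exact absurd hy (hr y i)
    all_goals simp [init]
  · intro j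
    constructor
    case mcv => exact hv
    case memw =>
      intro x hx
      left
      simp only [init] at hx ⊢
      split at hx
      · omega
      · simp at hx
    all_goals simp [init]

/-! ### Executions -/

/-- The ghost variable along an execution. -/
def ghost (E : Exec m n v0 j0) : ℕ → Fin m → ℤ
  | 0 => fun _ => -1
  | t + 1 => gstep (E.cfg t) (E.lbl t) (ghost E t)

theorem exec_inv (E : Exec m n v0 j0) (t : ℕ) (ht : t ≤ E.len) :
    Inv (E.cfg t) (ghost E t) := by
  induction t with
  | zero => rw [E.h0]; exact inv_init m n v0 j0
  | succ t ih => exact (ih (by omega)).step (E.hstep t (by omega))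

theorem exec_pre (E : Exec m n v0 j0) (x : ℤ) (s t : ℕ) (hst : s ≤ t) (ht : t ≤ E.len) :
    (E.cfg s).slr x <+: (E.cfg t).slr x := by
  induction t with
  | zero => have : s = 0 := by omega
            subst this; exact List.prefix_rfl
  | succ t ih =>
    by_cases h : s = t + 1
    · subst h; exact List.prefix_rfl
    · exact (ih (by omega) (by omega)).trans
        (Step.pre (exec_inv E t (by omega)) (E.hstep t (by omega)) x)

/-- Effect of a step on the idleness of reader `i`. -/
theorem Step.idle {c c' : Config m n} {l : Lbl m n} (hs : Step c l c') {i : Fin m}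
    (hl : l ≠ .invRead i) (hpc : (c'.rst i).pc ≠ .idle) : 
    (c.rst i).pc ≠ .idle ∧ ¬ isRespOf l (.rdr i) := by
  have key : ∀ (i' : Fin m) (s : RState m n), (i' = i → (c.rst i).pc ≠ .idle) →
      c'.rst = Function.update c.rst i' s → (c.rst i).pc ≠ .idle := by
    intro i' s h1 h2
    by_cases hii : i' = i
    · exact h1 hii
    · rw [h2, Function.update_of_ne (Ne.symm hii)] at hpc; exact hpc
  cases l with
  | invRead i' =>
    obtain ⟨h1, rfl⟩ := hs
    refine ⟨key i' _ (fun q => absurd (by rw [q]) hl) rfl, by simp [isRespOf]⟩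
  | respRead i' v =>
    obtain ⟨h1, -, rfl⟩ := hs
    refine ⟨key i' _ (fun q => by subst q; simp [h1]) rfl, ?_⟩
    rintro (⟨a, b, h2, h3⟩ | ⟨a, h2, h3⟩ | ⟨a, A, h2, h3⟩)
    · cases h2; cases h3; simp [upR] at hpc
    · cases h2
    · cases h2
  | invWrite j v => obtain ⟨h1, rfl⟩ := hs; exact ⟨hpc, by simp [isRespOf]⟩
  | respWrite j => obtain ⟨h1, rfl⟩ := hs; exact ⟨hpc, by simp [isRespOf]⟩
  | invAudit a => obtain ⟨h1, rfl⟩ := hs; exact ⟨hpc, by simp [isRespOf]⟩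
  | respAudit a A => obtain ⟨h1, -, rfl⟩ := hs; exact ⟨hpc, by simp [isRespOf]⟩
  | slrRead p x win =>
    refine ⟨?_, by simp [isRespOf]⟩
    obtain ⟨rfl, hs⟩ := hs
    cases p with
    | rdr i' =>
      rcases hs with ⟨h1, _, rfl⟩ | ⟨h1, _, rfl⟩ | ⟨h1, _, rfl⟩ | ⟨h1, _, rfl⟩ <;>
        exact key i' _ (fun q => by subst q; simp [h1]) rfl
    | wtr j => rcases hs with ⟨_, _, _, rfl⟩ | ⟨_, _, rfl⟩ | ⟨_, _, rfl⟩ <;> exact hpc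
    | adt a => rcases hs with ⟨_, _, rfl⟩ | ⟨_, _, rfl⟩ <;> exact hpc
  | slrWrite p x e =>
    refine ⟨?_, by simp [isRespOf]⟩
    cases p with
    | rdr i' =>
      obtain ⟨h1, rfl, rfl, rfl⟩ := hs
      exact key i' _ (fun q => by subst q; simp [h1]) rfl
    | wtr j =>
      obtain ⟨_, rfl, rfl, rfl⟩ := hs
      exact hpc
    | adt a => exact hs.elim
  | mRead p v =>
    refine ⟨?_, by simp [isRespOf]⟩
    obtain ⟨rfl, hs⟩ := hs
    cases p with
    | rdr i' =>
      rcases hs with ⟨h1, rfl⟩ | ⟨h1, rfl⟩ <;>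
        exact key i' _ (fun q => by subst q; simp [h1]) rfl
    | wtr j => obtain ⟨_, rfl⟩ := hs; exact hpc
    | adt a => obtain ⟨_, rfl⟩ := hs; exact hpc
  | mWrite p v =>
    refine ⟨?_, by simp [isRespOf]⟩
    cases p with
    | rdr i' =>
      rcases hs with ⟨h1, _, rfl⟩ | ⟨h1, _, _, rfl⟩ <;>
        exact key i' _ (fun q => by subst q; simp [h1]) rfl
    | wtr j => obtain ⟨_, _, rfl⟩ := hs; exact hpc
    | adt a => exact hs.elim
  | hRead j k a => obtain ⟨_, _, _, rfl⟩ := hs; exact ⟨hpc, by simp [isRespOf]⟩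
  | hWrite i' x =>
    refine ⟨?_, by simp [isRespOf]⟩
    obtain ⟨h1, _, rfl⟩ := hs
    exact key i' _ (fun q => by subst q; simp [h1]) rfl
  | tau p =>
    refine ⟨?_, by simp [isRespOf]⟩
    cases p with
    | rdr i' =>
      rcases hs with ⟨h1, _, rfl⟩ | ⟨h1, rfl⟩ <;>
        exact key i' _ (fun q => by subst q; simp [h1]) rfl
    | wtr j => obtain ⟨_, _, rfl⟩ := hs; exact hpc
    | adt a => exact hs.elim

theorem gstep_of_ne {c : Config m n} {l : Lbl m n} {G : Fin m → ℤ} {i : Fin m}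
    (hl : l ≠ .invRead i) : gstep c l G i = G i := by
  cases l with
  | invRead i' =>
    have : i ≠ i' := by rintro rfl; exact hl rfl
    simp [gstep, this]
  | _ => rfl

/-- A non-idle reader has a current READ. -/
theorem exec_current (E : Exec m n v0 j0) (i : Fin m) (t : ℕ) (ht : t ≤ E.len)
    (hpc : ((E.cfg t).rst i).pc ≠ .idle) :
    ∃ a, a < t ∧ E.lbl a = .invRead i ∧ ((E.cfg a).rst i).lsr = ghost E t i ∧
      ∀ s, a < s → s < t → ¬ isRespOf (E.lbl s) (.rdr i) := by
  induction t with
  | zero => rw [E.h0] at hpc; simp [init] at hpc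
  | succ t ih =>
    by_cases hl : E.lbl t = .invRead i
    · refine ⟨t, by omega, hl, by simp [ghost, hl, gstep], fun s h1 h2 => by omega⟩
    · obtain ⟨h1, h2⟩ := Step.idle (E.hstep t (by omega)) hl hpc
      obtain ⟨a, ha, hla, hg, hr⟩ := ih (by omega) h1
      refine ⟨a, by omega, hla, ?_, ?_⟩
      · rw [hg, ghost, gstep_of_ne hl]
      · intro s hs1 hs2
        by_cases hst : s = t
        · subst hst; exact h2
        · exact hr s hs1 (by omega)

/-- Every record is made by a READ for which it is the first record. -/
theorem exec_rec (E : Exec m n v0 j0) (i : Fin m) (T : ℕ) (hT : T ≤ E.len) (x : ℤ)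
    (hx : i ∈ readersOf ((E.cfg T).slr x)) :
    ∃ a t, a < t ∧ t < T ∧ E.lbl a = .invRead i ∧ ((E.cfg a).rst i).lsr < x ∧
      (∀ y, ((E.cfg a).rst i).lsr < y → y < x → i ∉ readersOf ((E.cfg T).slr y)) ∧
      (∀ s, a < s → s < t → ¬ isRespOf (E.lbl s) (.rdr i)) ∧
      (i ∈ preW ((E.cfg T).slr x) → E.lbl t = .slrWrite (.rdr i) x (.r i)) := by
  induction T generalizing x with
  | zero =>
    rw [E.h0] at hx
    simp only [init] at hx
    split at hx <;> simp [readersOf, preW, firstW] at hx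
  | succ T ih =>
    have hI := exec_inv E T (by omega)
    have hS := E.hstep T (by omega)
    by_cases hn : i ∈ readersOf ((E.cfg T).slr x)
    · obtain ⟨a, t, h1, h2, h3, h4, h5, h6, h7⟩ := ih (by omega) x hn
      refine ⟨a, t, h1, by omega, h3, h4, ?_, h6, ?_⟩
      · intro y hy1 hy2 hy
        obtain ⟨-, n2, n3, -⟩ := Step.newRec hI hS hy (h5 y hy1 hy2)
        have := n3 x hn
        omega
      · intro hp
        apply h7
        cases hw : hasW ((E.cfg T).slr x) with
        | true => rwa [preW_prefix (Step.pre hI hS x) hw] at hp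
        | false => rwa [readersOf_of_not hw] at hn
    · obtain ⟨n1, n2, n3, n4⟩ := Step.newRec hI hS hx hn
      obtain ⟨a, h1, h2, h3, h4⟩ := exec_current E i T (by omega) n1
      refine ⟨a, T, h1, by omega, h2, by omega, ?_, h4, ?_⟩
      · intro y hy1 hy2 hy
        by_cases hm : i ∈ readersOf ((E.cfg T).slr y)
        · have := n3 y hm; omega
        · obtain ⟨_, k2, k3, k4⟩ := Step.newRec hI hS hy hm
          rcases Step.slr_cases hI hS with q | ⟨_, _, _, q⟩ | ⟨_, _, q⟩
          · rw [q] at hy; exact hm hy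
          · have e1 := (q.recd hy hm).1
            have e2 := (q.recd hx hn).1
            omega
          · have e1 := (q.recd hy hm).1
            have e2 := (q.recd hx hn).1
            omega
      · intro hp
        exact n4.resolve_right fun q => q.1 hp

/-- Every operation has a matching response or is pending. -/
theorem exec_resp (E : Exec m n v0 j0) (p : Proc m n) (a : ℕ) :
    ∃ r, RespMatch E p a r := by
  classical
  by_cases h : ∃ b, a < b ∧ b < E.len ∧ isRespOf (E.lbl b) p
  · refine ⟨some (Nat.find h), (Nat.find_spec h).1, (Nat.find_spec h).2.1, (Nat.find_spec h).2.2, ?_⟩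
    intro t h1 h2 h3
    exact Nat.find_min h h2 ⟨h1, h2.trans (Nat.find_spec h).2.1, h3⟩
  · refine ⟨none, ?_⟩
    intro t h1 h2 h3
    exact h ⟨t, h1, h2, h3⟩

/-- Lemma `read_record_once`.  If a reader identifier `i`
belongs to `READERS(win)` for some sequence `win` held in the sliding
register `SLR[x]` (at some point of the execution), then there exists a
(classified, direct or helped) READ operation `op` by process `p_i` with
`idx(op) = x`. -/
theorem recorded_reader_has_read (m n : ℕ) (v0 : Val) (j0 : Fin n)
    (E : Exec m n v0 j0) (i : Fin m) (x : ℤ)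
    (hrec : ∃ t, t ≤ E.len ∧ i ∈ readersOf ((E.cfg t).slr x)) :
    ∃ o : OpData m n, IsOp E o ∧ o.proc = .rdr i ∧
      (o.kind = .directR ∨ o.kind = .helpedR) ∧ o.idx = x := by
  obtain ⟨t0, ht0, hx0⟩ := hrec
  have hx := readersOf_prefix (exec_pre E x t0 E.len ht0 le_rfl) hx0
  obtain ⟨a, t, h1, h2, h3, h4, h5, h6, h7⟩ := exec_rec E i E.len le_rfl x hx
  obtain ⟨r, hr⟩ := exec_resp E (.rdr i) a
  have hv : ∃ v : Val, ∀ k key, ReadValOK E ⟨.rdr i, a, r, k, x, key, v, ∅⟩ i := by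
    cases r with
    | none => exact ⟨wval ((E.cfg E.len).slr (x - 1)), fun _ _ => rfl⟩
    | some b =>
      obtain ⟨-, -, hb, -⟩ := hr
      rcases hb with ⟨i', v, q1, q2⟩ | ⟨_, q1, _⟩ | ⟨_, _, q1, _⟩
      · cases q1; exact ⟨v, fun _ _ => q2⟩
      · cases q1
      · cases q1
  obtain ⟨v, hv⟩ := hv
  by_cases hp : i ∈ preW ((E.cfg E.len).slr x)
  · have hkey := h7 hp
    refine ⟨⟨.rdr i, a, r, .directR, x, t, v, ∅⟩, ⟨by simp only; omega, hr, ?_⟩, rfl,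
      Or.inl rfl, rfl⟩
    refine ⟨i, rfl, h3, ⟨h4, hx, h5⟩, hp, h1, h2, hkey, ?_, hv _ _, rfl⟩
    intro b hb
    simp only at hb
    subst hb
    obtain ⟨hb1, hb2, hb3, hb4⟩ := hr
    simp only
    by_contra hc
    by_cases hbt : b = t
    · subst hbt
      rw [hkey] at hb3
      simp [isRespOf] at hb3
    · exact h6 b hb1 (by omega) hb3
  · refine ⟨⟨.rdr i, a, r, .helpedR, x, a, v, ∅⟩, ⟨by simp only; omega, hr, ?_⟩, rfl,
      Or.inr rfl, rfl⟩
    exact ⟨i, rfl, h3, ⟨h4, hx, h5⟩, hp, rfl, hv _ _, rfl⟩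

end Alg1
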